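/- There exists a positive constant M_2 such that for every n and every subset S of B_n × B_n, ν^P_n(S) ≤ M_2·ν^T_n(S) + O(n^{-1}), where the implied constant in the O-term is absolute (independent of S). -/

import Mathlib

open scoped Classical

inductive PTree : Type
  | leaf : PTree
  | node : PTree → PTree → PTree
deriving DecidableEq

namespace PTree

def size : PTree → ℕ
  | leaf => 1
  | node l r => size l + size r

def cherries : PTree → ℕ
  | leaf => 0
  | node leaf leaf => 1
  | node l r => cherries l + cherries r

def height : PTree → ℕ
  | leaf => 0
  | node l r => max (height l) (height r) + 1

def encode : PTree → ℕ
  | leaf => 0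
  | node l r => Nat.pair (encode l) (encode r) + 1

def normalize : PTree → PTree
  | leaf => leaf
  | node l r =>
      let l' := normalize l
      let r' := normalize r
      if encode l' ≤ encode r' then node l' r' else node r' l'

def isoFuns : PTree → PTree → List (ℕ → ℕ)
  | leaf, leaf => [fun i => i]
  | node l r, node l' r' =>
      ((isoFuns l l').flatMap fun g => (isoFuns r r').map fun h =>
        fun i => if i < l.size then g i else h (i - l.size) + l'.size)
      ++
      ((isoFuns l r').flatMap fun g => (isoFuns r l').map fun h =>
        fun i => if i < l.size then g i + l'.size else h (i - l.size))
  | _, _ => []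

def planeTrees : ℕ → Finset PTree
  | 0 => ∅
  | 1 => {leaf}
  | n + 2 =>
      (Finset.range (n + 1)).attach.biUnion fun k =>
        ((planeTrees (k.1 + 1)) ×ˢ (planeTrees (n + 1 - k.1))).image
          fun p => node p.1 p.2
  termination_by n => n
  decreasing_by
  · have := Finset.mem_range.mp k.2; omega
  · omega

def binTrees (n : ℕ) : Finset PTree := (planeTrees n).image normalize

/-- Triples (T, v, S): left plane tree, right plane tree, and a matching `v`
(a permutation of `0, …, n-1`, encoded as the list of its values) matching
leaf `i` of `T` with leaf `v i` of `S`. -/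
def Triples (n : ℕ) : Finset (PTree × PTree × List ℕ) :=
  (planeTrees n) ×ˢ ((planeTrees n) ×ˢ (List.range n).permutations.toFinset)

/-- Two triples represent the same tanglegram iff there are isomorphisms of the left
trees and of the right trees compatible with the matchings. -/
def equivTriple (n : ℕ) (t t' : PTree × PTree × List ℕ) : Bool :=
  (isoFuns t.1 t'.1).any fun φ => (isoFuns t.2.1 t'.2.1).any fun ψ =>
    (List.range n).all fun i => t'.2.2.getD (φ i) 0 == ψ (t.2.2.getD i 0)

/-- The tanglegrams of size `n`: equivalence classes of triples. -/
def tangleClasses (n : ℕ) : Finset (Finset (PTree × PTree × List ℕ)) :=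
  (Triples n).image fun t => (Triples n).filter (fun t' => equivTriple n t t' = true)

/-- The number of tanglegrams of size `n`. -/
def numTanglegrams (n : ℕ) : ℕ := (tangleClasses n).card

/-- The probability that a uniformly random tanglegram of size `n` satisfies the
(isomorphism-invariant) property `P` of triples. -/
noncomputable def tangleProb (n : ℕ) (P : PTree × PTree × List ℕ → Prop) : ℝ :=
  ((tangleClasses n).filter fun c => ∃ t ∈ c, P t).card / numTanglegrams n

/-- The expectation of the statistic `f` of a uniformly random tanglegram of size `n`. -/
noncomputable def tangleExp (n : ℕ) (f : PTree × PTree × List ℕ → ℕ) : ℝ :=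
  ∑' k : ℕ, (k : ℝ) * tangleProb n (fun t => f t = k)

end PTree

namespace PTree

/-- The distribution on pairs of binary trees (canonical representatives) induced by
the two halves of a uniformly random tanglegram of size `n`:
probability that the pair of isomorphism classes of the two trees lies in `S`. -/
noncomputable def nuT (n : ℕ) (S : Finset (PTree × PTree)) : ℝ :=
  tangleProb n fun t => (normalize t.1, normalize t.2.1) ∈ S

/-- The distribution on pairs of binary trees induced by two independent uniformly
random plane binary trees with `n` leaves. -/
noncomputable def nuP (n : ℕ) (S : Finset (PTree × PTree)) : ℝ :=
  (((planeTrees n) ×ˢ (planeTrees n)).filter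
      fun p => (normalize p.1, normalize p.2) ∈ S).card / ((planeTrees n).card ^ 2 : ℝ)

/-- The total variation distance between `nuT` and `nuP`. -/
noncomputable def tvDist (n : ℕ) : ℝ :=
  ((binTrees n ×ˢ binTrees n).powerset).sup' (Finset.powerset_nonempty _)
    fun S => |nuT n S - nuP n S|

/-- The number of occurrences of (trees isomorphic to) `B` as a fringe subtree of `T`. -/
def occ (B : PTree) : PTree → ℕ
  | leaf => if normalize leaf = normalize B then 1 else 0
  | node l r => (if normalize (node l r) = normalize B then 1 else 0) + occ B l + occ B r

/-- The number of generators of the automorphism group of `T`: the number of internal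
vertices whose two branches are isomorphic. -/
def gens : PTree → ℕ
  | leaf => 0
  | node l r => (if normalize l = normalize r then 1 else 0) + gens l + gens r

/-- `T` has a root branch isomorphic to `B`. -/
def hasBranch (B : PTree) : PTree → Prop
  | leaf => False
  | node l r => normalize l = normalize B ∨ normalize r = normalize B

/-- The cherries of a plane binary tree whose leaves are numbered from `k` on
(left to right), as pairs of leaf positions. -/
def cherryList : PTree → ℕ → List (ℕ × ℕ)
  | leaf, _ => []
  | node leaf leaf, k => [(k, k + 1)]
  | node l r, k => cherryList l k ++ cherryList r (k + l.size)

/-- The number of matched cherries: cherries of `T` whose two leaves are matched by `L`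
to the two leaves of a cherry of `S`. -/
def matchedCherries (T S : PTree) (L : List ℕ) : ℕ :=
  (cherryList T 0).countP fun p =>
    (cherryList S 0).any fun q =>
      (L.getD p.1 0 == q.1 && L.getD p.2 0 == q.2) ||
      (L.getD p.1 0 == q.2 && L.getD p.2 0 == q.1)

/-- The number of automorphisms of the tanglegram represented by the triple `(T, L, S)`:
pairs of automorphisms of the two trees compatible with the matching `L`. -/
def tangleAutCount (T S : PTree) (L : List ℕ) : ℕ :=
  ((isoFuns T T).map fun a =>
    (isoFuns S S).countP fun b =>
      (List.range T.size).all fun i => L.getD (a i) 0 == b (L.getD i 0)).sum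

/-- The number of automorphisms of `T` whose cycle type is `μ(s) = 2^s 1^(n-2s)`,
i.e. involutions of the leaves moving exactly `2 s` leaves. -/
def autMuCount (T : PTree) (s : ℕ) : ℕ :=
  (isoFuns T T).countP fun f =>
    ((List.range T.size).all fun i => f (f i) == i) &&
    ((List.range T.size).countP fun i => !(f i == i)) == 2 * s

end PTree

namespace PTree

section Counting

open scoped Pointwise
open Equiv (Perm)

variable {α : Type*}

theorem ssubset_nonempty_two_le_card {A A₁ : Finset α} (h : A₁ ⊂ A) (h₁ : A₁.Nonempty) :
    2 ≤ A.card := by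
  have := Finset.card_lt_card h
  have := h₁.card_pos
  omega

variable [DecidableEq α]

/-- The proper nonempty subsets of `A` that are preserved by `σ`. -/
def invSplits (σ : Perm α) (A : Finset α) : Finset (Finset α) :=
  A.ssubsets.filter fun A₁ => A₁.Nonempty ∧ σ • A₁ = A₁

/-- The proper nonempty subsets of `A` that `σ` exchanges with their complement in `A`. -/
def swapSplits (σ : Perm α) (A : Finset α) : Finset (Finset α) :=
  A.ssubsets.filter fun A₁ => A₁.Nonempty ∧ σ • A₁ = A \ A₁ ∧ σ • (A \ A₁) = A₁

/-- The number of leaf-labelled binary trees with label set `A` that are fixed by `σ`, defined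
through the decomposition at the root. -/
noncomputable def treeCount (σ : Perm α) (A : Finset α) : ℝ :=
  if A.card ≤ 1 then 1 else
    (∑ A₁ ∈ (invSplits σ A).attach, treeCount σ A₁.1 * treeCount σ (A \ A₁.1) +
      ∑ A₁ ∈ (swapSplits σ A).attach, treeCount (σ ^ 2) A₁.1) / 2
  termination_by A.card
  decreasing_by
  · have h := A₁.2
    simp only [invSplits, Finset.mem_filter, Finset.mem_ssubsets] at h
    exact Finset.card_lt_card h.1
  · have h := A₁.2
    simp only [invSplits, Finset.mem_filter, Finset.mem_ssubsets] at h
    exact Finset.card_lt_card (Finset.sdiff_ssubset h.1.1 h.2.1)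
  · have h := A₁.2
    simp only [swapSplits, Finset.mem_filter, Finset.mem_ssubsets] at h
    exact Finset.card_lt_card h.1

/-- The contribution to twice `treeCount σ A` of the root splits preserved by `σ`. -/
noncomputable def invSum (σ : Perm α) (A : Finset α) : ℝ :=
  ∑ A₁ ∈ invSplits σ A, treeCount σ A₁ * treeCount σ (A \ A₁)

/-- The contribution to twice `treeCount σ A` of the root splits exchanged by `σ`. -/
noncomputable def swapSum (σ : Perm α) (A : Finset α) : ℝ :=
  ∑ A₁ ∈ swapSplits σ A, treeCount (σ ^ 2) A₁

theorem mem_invSplits {σ : Perm α} {A A₁ : Finset α} :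
    A₁ ∈ invSplits σ A ↔ A₁ ⊂ A ∧ A₁.Nonempty ∧ σ • A₁ = A₁ := by
  simp [invSplits]

theorem mem_swapSplits {σ : Perm α} {A A₁ : Finset α} :
    A₁ ∈ swapSplits σ A ↔
      A₁ ⊂ A ∧ A₁.Nonempty ∧ σ • A₁ = A \ A₁ ∧ σ • (A \ A₁) = A₁ := by
  simp [swapSplits]

theorem treeCount_of_card_le_one {σ : Perm α} {A : Finset α} (hA : A.card ≤ 1) :
    treeCount σ A = 1 := by
  rw [treeCount, if_pos hA]

theorem two_mul_treeCount {σ : Perm α} {A : Finset α} (hA : 2 ≤ A.card) :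
    2 * treeCount σ A = invSum σ A + swapSum σ A := by
  rw [treeCount, if_neg (by omega), invSum, swapSum,
    Finset.sum_attach (invSplits σ A) fun A₁ => treeCount σ A₁ * treeCount σ (A \ A₁),
    Finset.sum_attach (swapSplits σ A) fun A₁ => treeCount (σ ^ 2) A₁]
  ring

theorem treeCount_nonneg (σ : Perm α) (A : Finset α) : 0 ≤ treeCount σ A := by
  induction hn : A.card using Nat.strong_induction_on generalizing σ A with
  | _ n ih =>
    subst hn
    by_cases hA : A.card ≤ 1
    · simp [treeCount_of_card_le_one hA]
    · have h := two_mul_treeCount (σ := σ) (A := A) (by omega)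
      have h₁ : 0 ≤ invSum σ A := Finset.sum_nonneg fun A₁ hA₁ => by
        rw [mem_invSplits] at hA₁
        exact mul_nonneg (ih _ (Finset.card_lt_card hA₁.1) _ _ rfl)
          (ih _ (Finset.card_lt_card (Finset.sdiff_ssubset hA₁.1.1 hA₁.2.1)) _ _ rfl)
      have h₂ : 0 ≤ swapSum σ A := Finset.sum_nonneg fun A₁ hA₁ => by
        rw [mem_swapSplits] at hA₁
        exact ih _ (Finset.card_lt_card hA₁.1) _ _ rfl
      linarith

theorem invSum_add_swapSum_le (σ : Perm α) (A : Finset α) :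
    invSum σ A + swapSum σ A ≤ 2 * treeCount σ A := by
  by_cases hA : 2 ≤ A.card
  · rw [two_mul_treeCount hA]
  · have h₁ : invSum σ A = 0 := Finset.sum_eq_zero fun A₁ h =>
      absurd (ssubset_nonempty_two_le_card (mem_invSplits.1 h).1 (mem_invSplits.1 h).2.1) hA
    have h₂ : swapSum σ A = 0 := Finset.sum_eq_zero fun A₁ h =>
      absurd (ssubset_nonempty_two_le_card (mem_swapSplits.1 h).1 (mem_swapSplits.1 h).2.1) hA
    have := treeCount_nonneg σ A
    linarith

theorem apply_mem_of_smul_eq {σ : Perm α} {A B : Finset α} (h : σ • A = B) {z : α}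
    (hz : z ∈ A) : σ z ∈ B := by
  rw [← h]
  exact Finset.smul_mem_smul_finset hz

theorem smul_eq_of_mapsTo {σ : Perm α} {A : Finset α} (h : ∀ z ∈ A, σ z ∈ A) : σ • A = A := by
  refine Finset.eq_of_subset_of_card_le ?_ (Finset.card_smul_finset σ A).ge
  intro z hz
  obtain ⟨y, hy, rfl⟩ := Finset.mem_smul_finset.1 hz
  exact h y hy

theorem smul_sdiff_eq {σ : Perm α} {A B : Finset α} (hA : σ • A = A) (hB : σ • B = B) :
    σ • (A \ B) = A \ B := by
  rw [Finset.smul_finset_sdiff, hA, hB]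

theorem sq_smul_eq_of_mem_swapSplits {σ : Perm α} {A A₁ : Finset α} (h : A₁ ∈ swapSplits σ A) :
    σ ^ 2 • A₁ = A₁ := by
  rw [mem_swapSplits] at h
  rw [pow_two, mul_smul, h.2.2.1, h.2.2.2]

theorem card_of_mem_swapSplits {σ : Perm α} {A A₁ : Finset α} (h : A₁ ∈ swapSplits σ A) :
    2 * A₁.card = A.card := by
  rw [mem_swapSplits] at h
  have h₁ := Finset.card_smul_finset σ A₁
  rw [h.2.2.1] at h₁
  have := Finset.card_sdiff_add_card_eq_card h.1.1
  omega

theorem sdiff_mem_swapSplits {σ : Perm α} {A A₁ : Finset α} (h : A₁ ∈ swapSplits σ A) :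
    A \ A₁ ∈ swapSplits σ A := by
  rw [mem_swapSplits] at h ⊢
  refine ⟨Finset.sdiff_ssubset h.1.1 h.2.1, ?_, ?_, ?_⟩
  · exact Finset.sdiff_nonempty.2 h.1.2
  · rw [Finset.sdiff_sdiff_eq_self h.1.1, h.2.2.2]
  · rw [Finset.sdiff_sdiff_eq_self h.1.1, h.2.2.1]

theorem sdiff_mem_invSplits {σ : Perm α} {A A₁ : Finset α} (hA : σ • A = A)
    (h : A₁ ∈ invSplits σ A) : A \ A₁ ∈ invSplits σ A := by
  rw [mem_invSplits] at h ⊢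
  exact ⟨Finset.sdiff_ssubset h.1.1 h.2.1, Finset.sdiff_nonempty.2 h.1.2,
    smul_sdiff_eq hA h.2.2⟩

theorem treeCount_congr {σ τ : Perm α} {A : Finset α} (hA : σ • A = A)
    (h : ∀ z ∈ A, σ z = τ z) : treeCount σ A = treeCount τ A := by
  induction hn : A.card using Nat.strong_induction_on generalizing σ τ A with
  | _ n ih =>
    subst hn
    have smul_congr : ∀ B ⊆ A, σ • B = τ • B := fun B hB =>
      Finset.image_congr fun z hz => h z (hB hz)
    by_cases hc : A.card ≤ 1
    · simp [treeCount_of_card_le_one hc]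
    have hi : invSplits σ A = invSplits τ A := by
      ext B
      rw [mem_invSplits, mem_invSplits]
      refine and_congr_right fun hB => ?_
      rw [smul_congr B hB.1]
    have hs : swapSplits σ A = swapSplits τ A := by
      ext B
      rw [mem_swapSplits, mem_swapSplits]
      refine and_congr_right fun hB => ?_
      rw [smul_congr B hB.1, smul_congr _ Finset.sdiff_subset]
    have h₁ : invSum σ A = invSum τ A := by
      rw [invSum, invSum, ← hi]
      refine Finset.sum_congr rfl fun B hB => ?_
      have hB' := mem_invSplits.1 hB
      have hB'' := mem_invSplits.1 (sdiff_mem_invSplits hA hB)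
      rw [ih _ (Finset.card_lt_card hB'.1) hB'.2.2 (fun z hz => h z (hB'.1.1 hz)) rfl,
        ih _ (Finset.card_lt_card hB''.1) hB''.2.2 (fun z hz => h z (hB''.1.1 hz)) rfl]
    have h₂ : swapSum σ A = swapSum τ A := by
      rw [swapSum, swapSum, ← hs]
      refine Finset.sum_congr rfl fun B hB => ?_
      have hB' := mem_swapSplits.1 hB
      refine ih _ (Finset.card_lt_card hB'.1) (sq_smul_eq_of_mem_swapSplits hB) (fun z hz => ?_) rfl
      have hz' := hB'.1.1 hz
      rw [pow_two, pow_two, Equiv.Perm.mul_apply, Equiv.Perm.mul_apply, ← h z hz',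
        h _ (apply_mem_of_smul_eq hA hz')]
    have := two_mul_treeCount (σ := σ) (A := A) (by omega)
    have := two_mul_treeCount (σ := τ) (A := A) (by omega)
    linarith

/-- The number of ways to extend a tree counted by `treeCount σ B` by one more cycle is at most
the number `2 * B.card - 1` of edges of the tree, including the one above the root. -/
noncomputable def extCount (σ : Perm α) (B : Finset α) : ℝ :=
  if B = ∅ then 1 else (2 * B.card - 1) * treeCount σ B

theorem extCount_empty (σ : Perm α) : extCount σ ∅ = 1 := if_pos rfl

theorem extCount_of_nonempty (σ : Perm α) {B : Finset α} (hB : B.Nonempty) :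
    extCount σ B = (2 * B.card - 1) * treeCount σ B :=
  if_neg hB.ne_empty

theorem extCount_nonneg (σ : Perm α) (B : Finset α) : 0 ≤ extCount σ B := by
  rcases B.eq_empty_or_nonempty with rfl | hB
  · simp [extCount_empty]
  · rw [extCount_of_nonempty σ hB]
    have : (1 : ℝ) ≤ B.card := by exact_mod_cast hB.card_pos
    exact mul_nonneg (by linarith) (treeCount_nonneg _ _)

theorem extCount_congr {σ τ : Perm α} {A : Finset α} (hA : σ • A = A)
    (h : ∀ z ∈ A, σ z = τ z) : extCount σ A = extCount τ A := by
  rw [extCount, extCount, treeCount_congr hA h]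

theorem sum_invSplits_comp_sdiff {σ : Perm α} {A : Finset α} (hA : σ • A = A)
    (f : Finset α → ℝ) : ∑ A₁ ∈ invSplits σ A, f (A \ A₁) = ∑ A₁ ∈ invSplits σ A, f A₁ := by
  refine Finset.sum_bij' (fun B _ => A \ B) (fun B _ => A \ B)
    (fun B hB => sdiff_mem_invSplits hA hB) (fun B hB => sdiff_mem_invSplits hA hB) ?_ ?_ ?_
  · exact fun B hB => Finset.sdiff_sdiff_eq_self (mem_invSplits.1 hB).1.1
  · exact fun B hB => Finset.sdiff_sdiff_eq_self (mem_invSplits.1 hB).1.1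
  · exact fun B hB => rfl

theorem two_mul_sum_invSplits_card_mul {σ : Perm α} {B : Finset α} (hB : σ • B = B) :
    2 * ∑ B₁ ∈ invSplits σ B,
        (2 * (B₁.card : ℝ) - 1) * (treeCount σ B₁ * treeCount σ (B \ B₁)) =
      (2 * B.card - 2) * invSum σ B := by
  have h := sum_invSplits_comp_sdiff hB fun B₁ =>
    (2 * (B₁.card : ℝ) - 1) * (treeCount σ B₁ * treeCount σ (B \ B₁))
  rw [two_mul]
  nth_rewrite 1 [← h]
  rw [← Finset.sum_add_distrib, invSum, Finset.mul_sum]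
  refine Finset.sum_congr rfl fun B₁ hB₁ => ?_
  have hs := (mem_invSplits.1 hB₁).1.1
  have hc : ((B \ B₁).card : ℝ) = B.card - B₁.card := by
    rw [eq_sub_iff_add_eq]
    exact_mod_cast Finset.card_sdiff_add_card_eq_card hs
  simp only [Finset.sdiff_sdiff_eq_self hs, hc]
  ring

theorem invSum_eq_two_mul {σ : Perm α} {A : Finset α} {x : α} (hA : σ • A = A) (hx : x ∈ A) :
    invSum σ A =
      2 * ∑ A₁ ∈ invSplits σ A with x ∈ A₁, treeCount σ A₁ * treeCount σ (A \ A₁) := by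
  have h : ∑ A₁ ∈ invSplits σ A with ¬ x ∈ A₁, treeCount σ A₁ * treeCount σ (A \ A₁) =
      ∑ A₁ ∈ invSplits σ A with x ∈ A₁, treeCount σ A₁ * treeCount σ (A \ A₁) := by
    have h' := sum_invSplits_comp_sdiff hA fun A₁ =>
      if x ∈ A₁ then treeCount σ A₁ * treeCount σ (A \ A₁) else 0
    rw [Finset.sum_filter, Finset.sum_filter, ← h']
    refine Finset.sum_congr rfl fun A₁ hA₁ => ?_
    have hs := (mem_invSplits.1 hA₁).1.1
    simp only [Finset.mem_sdiff, hx, true_and, Finset.sdiff_sdiff_eq_self hs]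
    split_ifs <;> ring
  rw [invSum, ← Finset.sum_filter_add_sum_filter_not _ (fun A₁ => x ∈ A₁), h, two_mul]

variable [Fintype α]

/-- The orbit of `x` under `σ`. -/
noncomputable def orb (σ : Perm α) (x : α) : Finset α :=
  Finset.univ.filter fun z => σ.SameCycle x z

theorem mem_orb {σ : Perm α} {x z : α} : z ∈ orb σ x ↔ σ.SameCycle x z := by
  simp [orb]

theorem self_mem_orb (σ : Perm α) (x : α) : x ∈ orb σ x :=
  mem_orb.2 (Equiv.Perm.SameCycle.refl σ x)

theorem apply_mem_orb {σ : Perm α} {x z : α} (h : z ∈ orb σ x) : σ z ∈ orb σ x :=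
  mem_orb.2 (Equiv.Perm.sameCycle_apply_right.2 (mem_orb.1 h))

theorem orb_apply (σ : Perm α) (x : α) : orb σ (σ x) = orb σ x := by
  ext z
  rw [mem_orb, mem_orb, Equiv.Perm.sameCycle_apply_left]

theorem smul_orb (σ : Perm α) (x : α) : σ • orb σ x = orb σ x :=
  smul_eq_of_mapsTo fun _ => apply_mem_orb

theorem orb_subset {σ : Perm α} {x : α} {A : Finset α} (hA : ∀ z ∈ A, σ z ∈ A) (hx : x ∈ A) :
    orb σ x ⊆ A := by
  intro z hz
  obtain ⟨i, -, rfl⟩ := (mem_orb.1 hz).exists_pow_eq'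
  clear hz
  induction i with
  | zero => simpa using hx
  | succ i ih => rw [pow_succ', Equiv.Perm.mul_apply]; exact hA _ ih

theorem orb_subset_of_smul_eq {σ : Perm α} {x : α} {A : Finset α} (hA : σ • A = A) (hx : x ∈ A) :
    orb σ x ⊆ A :=
  orb_subset (fun _ => apply_mem_of_smul_eq hA) hx

theorem orb_eq_singleton {σ : Perm α} {x : α} (h : σ x = x) : orb σ x = {x} := by
  refine (orb_subset ?_ (Finset.mem_singleton_self x)).antisymm
    (Finset.singleton_subset_iff.2 (self_mem_orb σ x))
  simp [h]

theorem inter_orb_of_mem_swapSplits {σ : Perm α} {A A₁ : Finset α} {x : α}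
    (h : A₁ ∈ swapSplits σ A) (hx : x ∈ A₁) : A₁ ∩ orb σ x = orb (σ ^ 2) x := by
  have h' := mem_swapSplits.1 h
  have h₁ := orb_subset_of_smul_eq (sq_smul_eq_of_mem_swapSplits h) hx
  have h₂ := orb_subset_of_smul_eq (sq_smul_eq_of_mem_swapSplits (sdiff_mem_swapSplits h))
    (apply_mem_of_smul_eq h'.2.2.1 hx)
  ext z
  rw [Finset.mem_inter]
  constructor
  · rintro ⟨hz, hzx⟩
    obtain ⟨i, -, rfl⟩ := (mem_orb.1 hzx).exists_pow_eq'
    obtain ⟨k, rfl | rfl⟩ := Nat.even_or_odd' i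
    · exact mem_orb.2 ⟨k, by rw [pow_mul, zpow_natCast]⟩
    · have : (σ ^ (2 * k + 1)) x ∈ orb (σ ^ 2) (σ x) :=
        mem_orb.2 ⟨k, by rw [pow_succ σ (2 * k), pow_mul, zpow_natCast, Equiv.Perm.mul_apply]⟩
      exact absurd hz (Finset.mem_sdiff.1 (h₂ this)).2
  · intro hz
    refine ⟨h₁ hz, mem_orb.2 ?_⟩
    obtain ⟨k, hk⟩ := mem_orb.1 hz
    exact ⟨2 * k, by rw [← hk, zpow_mul]; rfl⟩

theorem invSum_le {σ : Perm α} {A : Finset α} {x : α} (hA : σ • A = A) (hx : x ∈ A)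
    (ih : ∀ A₁ ∈ invSplits σ A, x ∈ A₁ → treeCount σ A₁ ≤ extCount σ (A₁ \ orb σ x)) :
    invSum σ A ≤
      if A \ orb σ x = ∅ then 0 else 2 * treeCount σ (A \ orb σ x) +
        (2 * (A \ orb σ x).card - 2) * invSum σ (A \ orb σ x) := by
  rw [invSum_eq_two_mul hA hx]
  set c := orb σ x with hc
  set B := A \ c with hBdef
  have hcA : c ⊆ A := orb_subset_of_smul_eq hA hx
  have hB : σ • B = B := smul_sdiff_eq hA (smul_orb σ x)
  split_ifs with hBe
  · rw [Finset.sum_eq_zero, mul_zero]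
    intro A₁ hA₁
    rw [Finset.mem_filter, mem_invSplits] at hA₁
    exact absurd ((Finset.sdiff_eq_empty_iff_subset.1 hBe).trans
      (orb_subset_of_smul_eq hA₁.1.2.2 hA₁.2)) hA₁.1.1.2
  have hBn : B.Nonempty := Finset.nonempty_iff_ne_empty.2 hBe
  rw [← two_mul_sum_invSplits_card_mul hB, ← mul_add]
  refine mul_le_mul_of_nonneg_left ?_ zero_le_two
  set s := (invSplits σ A).filter fun A₁ => x ∈ A₁ with hs
  have hsub : ∀ A₁ ∈ s, c ⊆ A₁ ∧ A₁ ∈ invSplits σ A := fun A₁ h => by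
    rw [hs, Finset.mem_filter] at h
    exact ⟨orb_subset_of_smul_eq (mem_invSplits.1 h.1).2.2 h.2, h.1⟩
  have hinj : Set.InjOn (fun A₁ => A₁ \ c) (s : Set (Finset α)) := by
    intro A₁ h₁ A₂ h₂ h
    rw [← Finset.sdiff_union_of_subset (hsub _ h₁).1, ← Finset.sdiff_union_of_subset (hsub _ h₂).1]
    exact congrArg (· ∪ c) h
  have himg : s.image (fun A₁ => A₁ \ c) ⊆ insert ∅ (invSplits σ B) := by
    intro B₁ h
    obtain ⟨A₁, hA₁, rfl⟩ := Finset.mem_image.1 h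
    obtain ⟨hcA₁, hi⟩ := hsub A₁ hA₁
    rw [mem_invSplits] at hi
    rw [Finset.mem_insert, mem_invSplits]
    refine or_iff_not_imp_left.2 fun hne => ⟨⟨Finset.sdiff_subset_sdiff hi.1.1 le_rfl, ?_⟩,
      Finset.nonempty_iff_ne_empty.2 hne, smul_sdiff_eq hi.2.2 (smul_orb σ x)⟩
    intro hle
    refine hi.1.2 ?_
    rw [← Finset.sdiff_union_of_subset hcA, ← Finset.sdiff_union_of_subset hcA₁]
    exact Finset.union_subset_union hle le_rfl
  calc ∑ A₁ ∈ s, treeCount σ A₁ * treeCount σ (A \ A₁)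
      ≤ ∑ A₁ ∈ s, extCount σ (A₁ \ c) * treeCount σ (B \ (A₁ \ c)) := by
        refine Finset.sum_le_sum fun A₁ hA₁ => ?_
        have : A \ A₁ = B \ (A₁ \ c) := by
          have := (hsub A₁ hA₁).1
          ext z
          have := @this z
          simp only [hBdef, Finset.mem_sdiff]
          tauto
        rw [this]
        exact mul_le_mul_of_nonneg_right (ih A₁ (hsub A₁ hA₁).2 (Finset.mem_filter.1 hA₁).2)
          (treeCount_nonneg _ _)
    _ = ∑ B₁ ∈ s.image (fun A₁ => A₁ \ c), extCount σ B₁ * treeCount σ (B \ B₁) :=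
        (Finset.sum_image
          (f := fun B₁ => extCount σ B₁ * treeCount σ (B \ B₁)) hinj).symm
    _ ≤ ∑ B₁ ∈ insert ∅ (invSplits σ B), extCount σ B₁ * treeCount σ (B \ B₁) :=
        Finset.sum_le_sum_of_subset_of_nonneg himg fun _ _ _ =>
          mul_nonneg (extCount_nonneg _ _) (treeCount_nonneg _ _)
    _ = _ := by
        rw [Finset.sum_insert (by simp [mem_invSplits]), extCount_empty, Finset.sdiff_empty,
          one_mul]
        refine congrArg _ (Finset.sum_congr rfl fun B₁ hB₁ => ?_)
        rw [extCount_of_nonempty σ (mem_invSplits.1 hB₁).2.1, mul_assoc]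

/-- The restrictions of the splits exchanged by `σ` to a union `B` of cycles of `σ`. -/
noncomputable def swapSplits' (σ : Perm α) (B : Finset α) : Finset (Finset α) :=
  if B = ∅ then {∅} else swapSplits σ B

theorem sum_swapSplits_le {σ : Perm α} {A : Finset α} {y : α} {t : Finset (Finset α)}
    (ht : t ⊆ swapSplits σ A) (hy : ∀ A₁ ∈ t, y ∈ A₁) :
    ∑ A₁ ∈ t, extCount (σ ^ 2) (A₁ \ orb σ y) ≤
      ∑ B₁ ∈ swapSplits' σ (A \ orb σ y), extCount (σ ^ 2) B₁ := by
  set c := orb σ y with hc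
  have hinj : Set.InjOn (fun A₁ => A₁ \ c) (t : Set (Finset α)) := by
    intro A₁ h₁ A₂ h₂ h
    rw [← Finset.sdiff_union_inter A₁ c, ← Finset.sdiff_union_inter A₂ c, hc,
      inter_orb_of_mem_swapSplits (ht h₁) (hy _ h₁), inter_orb_of_mem_swapSplits (ht h₂) (hy _ h₂)]
    exact congrArg (· ∪ _) h
  have himg : t.image (fun A₁ => A₁ \ c) ⊆ swapSplits' σ (A \ c) := by
    intro B₁ h
    obtain ⟨A₁, hA₁, rfl⟩ := Finset.mem_image.1 h
    have hi := mem_swapSplits.1 (ht hA₁)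
    have hd : (A \ c) \ (A₁ \ c) = (A \ A₁) \ c := by
      ext z
      simp only [Finset.mem_sdiff]
      tauto
    have h₁ : σ • (A₁ \ c) = (A \ A₁) \ c := by
      rw [Finset.smul_finset_sdiff, hi.2.2.1, hc, smul_orb]
    have h₂ : σ • ((A \ A₁) \ c) = A₁ \ c := by
      rw [Finset.smul_finset_sdiff, hi.2.2.2, hc, smul_orb]
    rw [swapSplits']
    split_ifs with hB
    · rw [Finset.mem_singleton, Finset.sdiff_eq_empty_iff_subset]
      exact hi.1.1.trans (Finset.sdiff_eq_empty_iff_subset.1 hB)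
    have hne₁ : (A₁ \ c).Nonempty := by
      by_contra hne
      rw [Finset.not_nonempty_iff_eq_empty] at hne
      rw [hne, Finset.smul_finset_empty] at h₁
      rw [hne, ← h₁, Finset.sdiff_empty] at hd
      exact hB hd
    refine mem_swapSplits.2 ⟨⟨Finset.sdiff_subset_sdiff hi.1.1 le_rfl, fun hle => ?_⟩, hne₁,
      by rw [hd, h₁], by rw [hd, h₂]⟩
    have h₃ := Finset.sdiff_eq_empty_iff_subset.2 hle
    rw [hd] at h₃
    rw [h₃, Finset.smul_finset_empty] at h₂
    exact hne₁.ne_empty h₂.symm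
  rw [← Finset.sum_image hinj]
  exact Finset.sum_le_sum_of_subset_of_nonneg himg fun _ _ _ => extCount_nonneg _ _

theorem swapSum_le {σ : Perm α} {A : Finset α} {x : α}
    (ih : ∀ A₁ ∈ swapSplits σ A, ∀ y ∈ A₁,
      treeCount (σ ^ 2) A₁ ≤ extCount (σ ^ 2) (A₁ \ orb (σ ^ 2) y)) (hx : x ∈ A) :
    swapSum σ A ≤
      if A \ orb σ x = ∅ then 2 else
        (2 * (A \ orb σ x).card - 2) * swapSum σ (A \ orb σ x) := by
  have key : ∀ A₁ ∈ swapSplits σ A, ∀ y ∈ A₁, orb σ y = orb σ x →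
      treeCount (σ ^ 2) A₁ ≤ extCount (σ ^ 2) (A₁ \ orb σ x) := by
    intro A₁ h y hy hyx
    refine (ih A₁ h y hy).trans_eq ?_
    rw [← inter_orb_of_mem_swapSplits h hy, Finset.sdiff_inter_self_left, hyx]
  have hσx : ∀ A₁ ∈ swapSplits σ A, x ∉ A₁ → σ x ∈ A₁ := fun A₁ h hxA₁ =>
    apply_mem_of_smul_eq (mem_swapSplits.1 h).2.2.2 (Finset.mem_sdiff.2 ⟨hx, hxA₁⟩)
  have h₁ : swapSum σ A ≤
      2 * ∑ B₁ ∈ swapSplits' σ (A \ orb σ x), extCount (σ ^ 2) B₁ := by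
    rw [swapSum, ← Finset.sum_filter_add_sum_filter_not _ (fun A₁ => x ∈ A₁), two_mul]
    refine add_le_add ?_ ?_
    · refine le_trans (Finset.sum_le_sum fun A₁ h => ?_)
        (sum_swapSplits_le (Finset.filter_subset _ _) fun A₁ h => (Finset.mem_filter.1 h).2)
      rw [Finset.mem_filter] at h
      exact key A₁ h.1 x h.2 rfl
    · refine le_trans (Finset.sum_le_sum fun A₁ h => ?_) ((sum_swapSplits_le (y := σ x)
        (Finset.filter_subset _ _) fun A₁ h => ?_).trans_eq (by rw [orb_apply]))
      · rw [Finset.mem_filter] at h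
        rw [orb_apply]
        exact key A₁ h.1 (σ x) (hσx A₁ h.1 h.2) (orb_apply σ x)
      · rw [Finset.mem_filter] at h
        exact hσx A₁ h.1 h.2
  refine h₁.trans_eq ?_
  rw [swapSplits']
  split_ifs with hB
  · simp [extCount_empty]
  · rw [swapSum, Finset.mul_sum, Finset.mul_sum]
    refine Finset.sum_congr rfl fun B₁ h => ?_
    rw [extCount_of_nonempty _ (mem_swapSplits.1 h).2.1, ← card_of_mem_swapSplits h]
    push_cast
    ring

/-- Removing a cycle from a labelled tree fixed by `σ`: the tree is determined by what remains and
the edge where the cycle was attached. -/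
theorem treeCount_le_extCount {σ : Perm α} {A : Finset α} {x : α} (hA : σ • A = A) (hx : x ∈ A) :
    treeCount σ A ≤ extCount σ (A \ orb σ x) := by
  induction hn : A.card using Nat.strong_induction_on generalizing σ A x with
  | _ n ih =>
    subst hn
    by_cases hc : A.card ≤ 1
    · have hAo : A \ orb σ x = ∅ := by
        rw [Finset.sdiff_eq_empty_iff_subset]
        intro z hz
        rw [Finset.card_le_one.1 hc z hz x hx]
        exact self_mem_orb σ x
      rw [treeCount_of_card_le_one hc, hAo, extCount_empty]
    have h₀ := two_mul_treeCount (σ := σ) (A := A) (by omega)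
    have h₁ := invSum_le hA hx fun A₁ h hxA₁ =>
      ih _ (Finset.card_lt_card (mem_invSplits.1 h).1) (mem_invSplits.1 h).2.2 hxA₁ rfl
    have h₂ := swapSum_le (σ := σ) (fun A₁ h y hy =>
      ih _ (Finset.card_lt_card (mem_swapSplits.1 h).1) (sq_smul_eq_of_mem_swapSplits h) hy rfl) hx
    rw [extCount]
    split_ifs at h₁ h₂ ⊢ with hB
    · linarith
    · have hB' : (1 : ℝ) ≤ (A \ orb σ x).card := by
        exact_mod_cast (Finset.nonempty_iff_ne_empty.2 hB).card_pos
      have h₃ := mul_le_mul_of_nonneg_left (invSum_add_swapSum_le σ (A \ orb σ x))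
        (by linarith : (0 : ℝ) ≤ 2 * (A \ orb σ x).card - 2)
      nlinarith

/-- The permutations that fix every point outside `A`. -/
def permsOn (A : Finset α) : Finset (Perm α) :=
  Finset.univ.filter fun σ => ∀ z ∉ A, σ z = z

theorem mem_permsOn {A : Finset α} {σ : Perm α} : σ ∈ permsOn A ↔ ∀ z ∉ A, σ z = z := by
  simp [permsOn]

theorem apply_mem_of_mem_permsOn {A : Finset α} {σ : Perm α} (h : σ ∈ permsOn A) {z : α}
    (hz : z ∈ A) : σ z ∈ A := by
  by_contra hc
  have := σ.injective (mem_permsOn.1 h _ hc)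
  rw [this] at hc
  exact hc hz

theorem smul_eq_of_mem_permsOn {A : Finset α} {σ : Perm α} (h : σ ∈ permsOn A) : σ • A = A :=
  smul_eq_of_mapsTo fun _ => apply_mem_of_mem_permsOn h

/-- By Burnside's lemma, an upper bound for `A.card !` times the number of tanglegrams. -/
noncomputable def sqSum (A : Finset α) : ℝ :=
  ∑ σ ∈ permsOn A, treeCount σ A ^ 2

/-- The analogue of `sqSum` with the cycle of `x` removed from each tree. -/
noncomputable def extSqSum (A : Finset α) (x : α) : ℝ :=
  ∑ σ ∈ permsOn A, extCount σ (A \ orb σ x) ^ 2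

/-- The part of `extSqSum` coming from the permutations that move `x`. -/
noncomputable def movedSqSum (A : Finset α) (x : α) : ℝ :=
  ∑ σ ∈ permsOn A with σ x ≠ x, extCount σ (A \ orb σ x) ^ 2

/-- The number of leaf-labelled binary trees with `n` leaves, that is `(2 * n - 3)‼`. -/
noncomputable def labelledCount : ℕ → ℝ
  | 0 => 1
  | 1 => 1
  | n + 2 => (2 * n + 1) * labelledCount (n + 1)

theorem labelledCount_succ {n : ℕ} (hn : 1 ≤ n) :
    labelledCount (n + 1) = (2 * n - 1) * labelledCount n := by
  obtain ⟨m, rfl⟩ := Nat.exists_eq_add_of_le' hn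
  rw [labelledCount]
  push_cast
  ring

theorem labelledCount_pos (n : ℕ) : 0 < labelledCount n := by
  induction n using Nat.strong_induction_on with
  | _ n ih =>
    match n with
    | 0 => simp [labelledCount]
    | 1 => simp [labelledCount]
    | n + 2 =>
      rw [labelledCount]
      have := ih (n + 1) (by omega)
      positivity

theorem treeCount_one_le {A : Finset α} : treeCount 1 A ≤ labelledCount A.card := by
  induction hn : A.card generalizing A with
  | zero => rw [treeCount_of_card_le_one (by omega), labelledCount]
  | succ n ih =>
    by_cases hn1 : n = 0
    · subst hn1
      rw [treeCount_of_card_le_one (by omega), labelledCount]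
    obtain ⟨x, hx⟩ := Finset.card_pos.1 (by omega : 0 < A.card)
    refine (treeCount_le_extCount (one_smul _ A) hx).trans ?_
    rw [orb_eq_singleton (Equiv.Perm.one_apply x), Finset.sdiff_singleton_eq_erase]
    have hc : (A.erase x).card = n := by rw [Finset.card_erase_of_mem hx]; omega
    have hn' : (1 : ℝ) ≤ n := by exact_mod_cast Nat.one_le_iff_ne_zero.2 hn1
    rw [extCount_of_nonempty _ (Finset.card_pos.1 (by omega)), hc, labelledCount_succ (by omega)]
    exact mul_le_mul_of_nonneg_left (ih hc) (by linarith)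

theorem erase_sdiff_orb_swap_mul {σ : Perm α} {A : Finset α} {x : α} :
    (A.erase x) \ orb (Equiv.swap x (σ x) * σ) (σ x) = A \ orb σ x := by
  set τ := Equiv.swap x (σ x) * σ with hτ
  have hτz : ∀ z, τ z = Equiv.swap x (σ x) (σ z) := fun z => rfl
  have h₁ : orb τ (σ x) ⊆ orb σ x := by
    refine orb_subset (fun z hz => ?_) (apply_mem_orb (self_mem_orb σ x))
    rw [hτz, Equiv.swap_apply_def]
    split_ifs
    · exact apply_mem_orb (self_mem_orb σ x)
    · exact self_mem_orb σ x
    · exact apply_mem_orb hz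
  have h₂ : orb σ x ⊆ insert x (orb τ (σ x)) := by
    refine orb_subset (fun z hz => ?_) (Finset.mem_insert_self _ _)
    rw [Finset.mem_insert] at hz ⊢
    rcases hz with rfl | hz
    · exact Or.inr (self_mem_orb _ _)
    · have h := apply_mem_orb hz
      rw [hτz, Equiv.swap_apply_def] at h
      split_ifs at h with h' h''
      · exact Or.inl h'
      · exact Or.inr (h'' ▸ self_mem_orb _ _)
      · exact Or.inr h
  ext z
  have h₁' := @h₁ z
  have h₂' := @h₂ z
  have h₃ : z = x → z ∈ orb σ x := fun h => h ▸ self_mem_orb σ x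
  rw [Finset.mem_insert] at h₂'
  simp only [Finset.mem_sdiff, Finset.mem_erase]
  tauto

theorem movedSqSum_le {A : Finset α} {x : α} :
    movedSqSum A x ≤ ∑ y ∈ A.erase x, extSqSum (A.erase x) y := by
  let g : α × Perm α → ℝ := fun p => extCount p.2 (A.erase x \ orb p.2 p.1) ^ 2
  have hR : ∑ y ∈ A.erase x, extSqSum (A.erase x) y =
      ∑ p ∈ A.erase x ×ˢ permsOn (A.erase x), g p :=
    (Finset.sum_product (A.erase x) (permsOn (A.erase x)) g).symm
  rw [hR, movedSqSum]
  set s := (permsOn A).filter fun σ => σ x ≠ x with hs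
  let f : Perm α → α × Perm α := fun σ => (σ x, Equiv.swap x (σ x) * σ)
  have hinj : Set.InjOn f (s : Set (Perm α)) := by
    intro σ _ τ _ h
    simp only [f, Prod.mk.injEq] at h
    rw [h.1] at h
    exact mul_left_cancel h.2
  have himg : s.image f ⊆ A.erase x ×ˢ permsOn (A.erase x) := by
    intro p hp
    obtain ⟨σ, hσ, rfl⟩ := Finset.mem_image.1 hp
    rw [hs, Finset.mem_filter] at hσ
    have hxA : x ∈ A := by
      by_contra hxA
      exact hσ.2 (mem_permsOn.1 hσ.1 x hxA)
    rw [Finset.mem_product]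
    refine ⟨Finset.mem_erase.2 ⟨hσ.2, apply_mem_of_mem_permsOn hσ.1 hxA⟩, mem_permsOn.2 ?_⟩
    intro z hz
    rw [Finset.mem_erase, not_and_or, not_not] at hz
    simp only [f, Equiv.Perm.mul_apply]
    by_cases hzx : z = x
    · rw [hzx, Equiv.swap_apply_right]
    · have hzA := hz.resolve_left hzx
      rw [mem_permsOn.1 hσ.1 z hzA, Equiv.swap_apply_of_ne_of_ne hzx]
      rintro rfl
      exact hzA (apply_mem_of_mem_permsOn hσ.1 hxA)
  calc ∑ σ ∈ s, extCount σ (A \ orb σ x) ^ 2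
      = ∑ σ ∈ s, g (f σ) := by
        refine Finset.sum_congr rfl fun σ hσ => ?_
        rw [hs, Finset.mem_filter] at hσ
        simp only [f, g]
        rw [erase_sdiff_orb_swap_mul, extCount_congr
          (smul_sdiff_eq (smul_eq_of_mem_permsOn hσ.1) (smul_orb σ x)) fun z hz => ?_]
        rw [Finset.mem_sdiff] at hz
        rw [Equiv.Perm.mul_apply, Equiv.swap_apply_of_ne_of_ne]
        · intro h
          refine hz.2 (mem_orb.2 ((Equiv.Perm.sameCycle_apply_right).1 ?_))
          rw [h]
        · intro h
          exact hz.2 (σ.injective h ▸ self_mem_orb σ x)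
    _ = ∑ p ∈ s.image f, g p := (Finset.sum_image hinj).symm
    _ ≤ _ := Finset.sum_le_sum_of_subset_of_nonneg himg fun _ _ _ => sq_nonneg _

theorem extSqSum_eq {A : Finset α} {x : α} (hA : 2 ≤ A.card) (hx : x ∈ A) :
    extSqSum A x =
      (2 * (A.card - 1 : ℝ) - 1) ^ 2 * sqSum (A.erase x) + movedSqSum A x := by
  rw [extSqSum, ← Finset.sum_filter_add_sum_filter_not _ (fun σ => σ x = x), movedSqSum]
  congr 1
  have hf : (permsOn A).filter (fun σ => σ x = x) = permsOn (A.erase x) := by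
    ext σ
    rw [Finset.mem_filter, mem_permsOn, mem_permsOn]
    constructor
    · rintro ⟨h, hσx⟩ z hz
      by_cases hzx : z = x
      · rw [hzx, hσx]
      · exact h z fun hzA => hz (Finset.mem_erase.2 ⟨hzx, hzA⟩)
    · exact fun h => ⟨fun z hz => h z fun hz' => hz (Finset.mem_of_mem_erase hz'),
        h x (Finset.notMem_erase x A)⟩
  rw [hf, sqSum, Finset.mul_sum]
  refine Finset.sum_congr rfl fun σ hσ => ?_
  have hc : (A.erase x).card = A.card - 1 := Finset.card_erase_of_mem hx
  rw [orb_eq_singleton (mem_permsOn.1 hσ x (Finset.notMem_erase x A)),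
    Finset.sdiff_singleton_eq_erase, extCount_of_nonempty _ (Finset.card_pos.1 (by omega)), hc,
    Nat.cast_sub (by omega)]
  push_cast
  ring

theorem sqSum_le (A : Finset α) :
    sqSum A ≤ labelledCount A.card ^ 2 + (∑ x ∈ A, movedSqSum A x) / 2 := by
  have h1 : (1 : Perm α) ∈ permsOn A := mem_permsOn.2 fun _ _ => rfl
  rw [sqSum, ← Finset.add_sum_erase _ _ h1]
  refine add_le_add (pow_le_pow_left₀ (treeCount_nonneg _ _) treeCount_one_le 2) ?_
  rw [le_div_iff₀ two_pos, Finset.sum_mul]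
  have hle : ∀ x ∈ A, ∑ σ ∈ (permsOn A).erase 1, (if σ x ≠ x then treeCount σ A ^ 2 else 0) ≤
      movedSqSum A x := by
    intro x hx
    rw [movedSqSum, Finset.sum_filter]
    refine (Finset.sum_le_sum_of_subset_of_nonneg (Finset.erase_subset _ _) fun _ _ _ => ?_).trans
      (Finset.sum_le_sum fun σ hσ => ?_)
    · split_ifs <;> positivity
    · split_ifs with h
      · exact pow_le_pow_left₀ (treeCount_nonneg _ _)
          (treeCount_le_extCount (smul_eq_of_mem_permsOn hσ) hx) 2
      · exact le_rfl
  refine le_trans ?_ (Finset.sum_le_sum hle)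
  rw [Finset.sum_comm]
  refine Finset.sum_le_sum fun σ hσ => ?_
  rw [Finset.mem_erase] at hσ
  rw [← Finset.sum_filter, Finset.sum_const, nsmul_eq_mul, mul_comm]
  refine mul_le_mul_of_nonneg_right ?_ (sq_nonneg _)
  have h2 : 2 ≤ σ.support.card := Equiv.Perm.two_le_card_support_of_ne_one hσ.1
  have hsub : σ.support ⊆ A.filter fun x => σ x ≠ x := by
    intro x hx
    rw [Equiv.Perm.mem_support] at hx
    refine Finset.mem_filter.2 ⟨?_, hx⟩
    by_contra hxA
    exact hx (mem_permsOn.1 hσ.2 x hxA)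
  exact_mod_cast h2.trans (Finset.card_le_card hsub)

theorem permsOn_eq_of_card_eq_one {A : Finset α} (hA : A.card = 1) : permsOn A = {1} := by
  obtain ⟨x, rfl⟩ := Finset.card_eq_one.1 hA
  ext σ
  rw [Finset.mem_singleton]
  constructor
  · intro h
    ext z
    by_cases hz : z = x
    · rw [hz, Equiv.Perm.one_apply]
      simpa using apply_mem_of_mem_permsOn h (Finset.mem_singleton_self x)
    · exact mem_permsOn.1 h z (by simpa using hz)
  · rintro rfl
    exact mem_permsOn.2 fun _ _ => rfl

theorem sqSum_extSqSum_bounds {n : ℕ} (hn : 1 ≤ n) :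
    (∀ A : Finset α, A.card = n → sqSum A ≤ 3 * labelledCount n ^ 2) ∧
    (∀ A : Finset α, A.card = n → ∀ x ∈ A,
      extSqSum A x ≤ (if n = 1 then 1 else 6) * labelledCount n ^ 2) := by
  induction n, hn using Nat.le_induction with
  | base =>
    refine ⟨fun A hA => ?_, fun A hA x hx => ?_⟩
    · rw [sqSum, permsOn_eq_of_card_eq_one hA, Finset.sum_singleton,
        treeCount_of_card_le_one hA.le, labelledCount]
      norm_num
    · have : A \ orb 1 x = ∅ := by
        obtain ⟨y, rfl⟩ := Finset.card_eq_one.1 hA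
        rw [Finset.mem_singleton] at hx
        rw [hx, orb_eq_singleton (Equiv.Perm.one_apply y), Finset.sdiff_self]
      rw [extSqSum, permsOn_eq_of_card_eq_one hA, Finset.sum_singleton, this, extCount_empty,
        labelledCount]
      norm_num
  | succ n hn ih =>
    have hmoved : ∀ A : Finset α, A.card = n + 1 → ∀ x ∈ A,
        movedSqSum A x ≤ n * ((if n = 1 then 1 else 6) * labelledCount n ^ 2) := by
      intro A hA x hx
      have hc : (A.erase x).card = n := by rw [Finset.card_erase_of_mem hx]; omega
      refine movedSqSum_le.trans ((Finset.sum_le_sum (ih.2 _ hc)).trans_eq ?_)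
      rw [Finset.sum_const, hc, nsmul_eq_mul]
    have hpos := sq_nonneg (labelledCount n)
    rw [labelledCount_succ hn, mul_pow]
    refine ⟨fun A hA => ?_, fun A hA x hx => ?_⟩
    · have h := sqSum_le A
      have h' := Finset.sum_le_sum (hmoved A hA)
      rw [Finset.sum_const, hA, nsmul_eq_mul] at h'
      rw [hA, labelledCount_succ hn, mul_pow] at h
      push_cast at h'
      split_ifs at h' with h1
      · subst h1
        norm_num at h h' ⊢
        linarith
      · have h2 : (2 : ℝ) ≤ n := by exact_mod_cast (by omega : 2 ≤ n)
        nlinarith [mul_nonneg (by nlinarith : (0 : ℝ) ≤ 5 * n ^ 2 - 11 * n + 2) hpos]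
    · have hc : (A.erase x).card = n := by rw [Finset.card_erase_of_mem hx]; omega
      have h := hmoved A hA x hx
      have h' := mul_le_mul_of_nonneg_left (ih.1 _ hc) (sq_nonneg (2 * (n : ℝ) - 1))
      rw [extSqSum_eq (by omega) hx, hA, if_neg (by omega)]
      push_cast
      rw [add_sub_cancel_right]
      split_ifs at h with h1
      · subst h1
        norm_num at h h' ⊢
        linarith
      · have h2 : (2 : ℝ) ≤ n := by exact_mod_cast (by omega : 2 ≤ n)
        nlinarith [mul_nonneg (by nlinarith : (0 : ℝ) ≤ (2 * n - 1) ^ 2 - 2 * n) hpos]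

theorem sum_treeCount_univ_sq_le [Nonempty α] :
    ∑ σ : Perm α, treeCount σ Finset.univ ^ 2 ≤ 3 * labelledCount (Fintype.card α) ^ 2 := by
  have h := (sqSum_extSqSum_bounds Fintype.card_pos).1 (Finset.univ : Finset α) rfl
  have hu : permsOn (Finset.univ : Finset α) = Finset.univ :=
    Finset.eq_univ_of_forall fun σ => mem_permsOn.2 fun z hz => absurd (Finset.mem_univ z) hz
  rwa [sqSum, hu] at h

end Counting

section Hierarchy

open scoped Pointwise
open Equiv (Perm)

variable {α : Type*} [DecidableEq α]

theorem disjoint_smul_finset (σ : Perm α) {A₁ A₂ : Finset α} (h : Disjoint A₁ A₂) :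
    Disjoint (σ • A₁) (σ • A₂) := by
  rw [Finset.disjoint_iff_inter_eq_empty] at h ⊢
  rw [← Finset.smul_finset_inter, h, Finset.smul_finset_empty]

/-- `IsHierarchy A H` means that `H` is the set of the label sets of the fringe subtrees of a binary
tree whose leaves are labelled bijectively by `A`. -/
inductive IsHierarchy : Finset α → Finset (Finset α) → Prop
  | leaf (a : α) : IsHierarchy {a} {{a}}
  | node {A₁ A₂ : Finset α} {H₁ H₂ : Finset (Finset α)} (h₁ : IsHierarchy A₁ H₁)
      (h₂ : IsHierarchy A₂ H₂) (hd : Disjoint A₁ A₂) :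
      IsHierarchy (A₁ ∪ A₂) (insert (A₁ ∪ A₂) (H₁ ∪ H₂))

namespace IsHierarchy

variable {A A₁ A₂ : Finset α} {H H₁ H₂ : Finset (Finset α)}

theorem nonempty (h : IsHierarchy A H) : A.Nonempty := by
  induction h with
  | leaf a => exact Finset.singleton_nonempty a
  | node _ _ _ ih _ => exact ih.mono Finset.subset_union_left

theorem self_mem (h : IsHierarchy A H) : A ∈ H := by
  cases h with
  | leaf a => exact Finset.mem_singleton_self _
  | node _ _ _ => exact Finset.mem_insert_self _ _

theorem subset_and_nonempty_of_mem (h : IsHierarchy A H) {C : Finset α} (hC : C ∈ H) :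
    C ⊆ A ∧ C.Nonempty := by
  induction h with
  | leaf a =>
    rw [Finset.mem_singleton] at hC
    subst hC
    exact ⟨le_rfl, Finset.singleton_nonempty a⟩
  | node h₁ h₂ _ ih₁ ih₂ =>
    rw [Finset.mem_insert, Finset.mem_union] at hC
    rcases hC with rfl | hC | hC
    · exact ⟨le_rfl, h₁.nonempty.mono Finset.subset_union_left⟩
    · exact ⟨(ih₁ hC).1.trans Finset.subset_union_left, (ih₁ hC).2⟩
    · exact ⟨(ih₂ hC).1.trans Finset.subset_union_right, (ih₂ hC).2⟩

theorem eq_of_eq {B : Finset α} (hA : IsHierarchy A H) (hB : IsHierarchy B H) : A = B :=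
  (hB.subset_and_nonempty_of_mem hA.self_mem).1.antisymm
    (hA.subset_and_nonempty_of_mem hB.self_mem).1

theorem smul (h : IsHierarchy A H) (σ : Perm α) : IsHierarchy (σ • A) (σ • H) := by
  induction h with
  | leaf a =>
    rw [Finset.smul_finset_singleton, Finset.smul_finset_singleton, Finset.smul_finset_singleton]
    exact leaf _
  | node _ _ hd ih₁ ih₂ =>
    rw [Finset.smul_finset_insert, Finset.smul_finset_union, Finset.smul_finset_union]
    exact node ih₁ ih₂ (disjoint_smul_finset σ hd)

theorem filter_subset_eq (h₁ : IsHierarchy A₁ H₁) (h₂ : IsHierarchy A₂ H₂)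
    (hd : Disjoint A₁ A₂) :
    (insert (A₁ ∪ A₂) (H₁ ∪ H₂)).filter (· ⊆ A₁) = H₁ := by
  have key : ∀ C : Finset α, C.Nonempty → C ⊆ A₂ → ¬ C ⊆ A₁ := fun C hC hC₂ hC₁ =>
    hC.ne_empty (Finset.disjoint_self_iff_empty C |>.1 (Finset.disjoint_of_subset_left hC₁
      (Finset.disjoint_of_subset_right hC₂ hd)))
  ext C
  rw [Finset.mem_filter, Finset.mem_insert, Finset.mem_union]
  constructor
  · rintro ⟨rfl | hC | hC, hC'⟩
    · exact absurd (Finset.union_subset_iff.1 hC').2 (key A₂ h₂.nonempty le_rfl)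
    · exact hC
    · exact absurd hC' (key C (h₂.subset_and_nonempty_of_mem hC).2
        (h₂.subset_and_nonempty_of_mem hC).1)
  · exact fun hC => ⟨Or.inr (Or.inl hC), (h₁.subset_and_nonempty_of_mem hC).1⟩

theorem eq_sdiff_of_disjoint (hd : Disjoint A₁ A₂) : A₂ = (A₁ ∪ A₂) \ A₁ :=
  (Finset.union_sdiff_cancel_left hd).symm

/-- The two branches at the root of a hierarchy are determined up to order. -/
theorem node_inj {B₁ B₂ : Finset α} {K₁ K₂ : Finset (Finset α)} (h₁ : IsHierarchy A₁ H₁)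
    (h₂ : IsHierarchy A₂ H₂) (hd : Disjoint A₁ A₂) (k₁ : IsHierarchy B₁ K₁)
    (k₂ : IsHierarchy B₂ K₂) (hd' : Disjoint B₁ B₂)
    (h : insert (A₁ ∪ A₂) (H₁ ∪ H₂) = insert (B₁ ∪ B₂) (K₁ ∪ K₂)) :
    (A₁ = B₁ ∧ H₁ = K₁ ∧ A₂ = B₂ ∧ H₂ = K₂) ∨ (A₁ = B₂ ∧ H₁ = K₂ ∧ A₂ = B₁ ∧ H₂ = K₁) := by
  have hU : A₁ ∪ A₂ = B₁ ∪ B₂ := (node h₁ h₂ hd).eq_of_eq (h ▸ node k₁ k₂ hd')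
  have straight : ∀ {B₁ B₂ : Finset α} {K₁ K₂ : Finset (Finset α)}, IsHierarchy B₁ K₁ →
      IsHierarchy B₂ K₂ → Disjoint B₁ B₂ → A₁ ∪ A₂ = B₁ ∪ B₂ →
      insert (A₁ ∪ A₂) (H₁ ∪ H₂) = insert (B₁ ∪ B₂) (K₁ ∪ K₂) → A₁ ⊆ B₁ →
      A₁ = B₁ ∧ H₁ = K₁ ∧ A₂ = B₂ ∧ H₂ = K₂ := by
    intro B₁ B₂ K₁ K₂ k₁ k₂ hd' hU h hs
    have hB₁ : B₁ ∈ insert (A₁ ∪ A₂) (H₁ ∪ H₂) :=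
      h ▸ Finset.mem_insert_of_mem (Finset.mem_union_left _ k₁.self_mem)
    obtain ⟨b, hb⟩ := k₂.nonempty
    obtain ⟨a, ha⟩ := h₁.nonempty
    have hA₁ : A₁ = B₁ := by
      rw [Finset.mem_insert, Finset.mem_union] at hB₁
      rcases hB₁ with hB₁ | hB₁ | hB₁
      · have : b ∈ B₁ := by
          rw [hB₁, hU]
          exact Finset.mem_union_right _ hb
        exact absurd hb (Finset.disjoint_left.1 hd' this)
      · exact hs.antisymm (h₁.subset_and_nonempty_of_mem hB₁).1
      · exact absurd ((h₂.subset_and_nonempty_of_mem hB₁).1 (hs ha))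
          (Finset.disjoint_left.1 hd ha)
    have hA₂ : A₂ = B₂ := by
      rw [eq_sdiff_of_disjoint hd, hU, hA₁]
      exact (eq_sdiff_of_disjoint hd').symm
    refine ⟨hA₁, ?_, hA₂, ?_⟩
    · rw [← filter_subset_eq h₁ h₂ hd, ← filter_subset_eq k₁ k₂ hd', h, hA₁]
    · rw [← filter_subset_eq h₂ h₁ hd.symm, ← filter_subset_eq k₂ k₁ hd'.symm,
        Finset.union_comm A₂, Finset.union_comm H₂, h, hA₂, Finset.union_comm B₂,
        Finset.union_comm K₂]
  have hA₁ : A₁ ∈ insert (B₁ ∪ B₂) (K₁ ∪ K₂) :=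
    h ▸ Finset.mem_insert_of_mem (Finset.mem_union_left _ h₁.self_mem)
  rw [Finset.mem_insert, Finset.mem_union] at hA₁
  rcases hA₁ with hA₁ | hA₁ | hA₁
  · obtain ⟨b, hb⟩ := h₂.nonempty
    have : b ∈ A₁ := by
      rw [hA₁, ← hU]
      exact Finset.mem_union_right _ hb
    exact absurd hb (Finset.disjoint_left.1 hd this)
  · exact Or.inl (straight k₁ k₂ hd' hU h (k₁.subset_and_nonempty_of_mem hA₁).1)
  · refine Or.inr (straight k₂ k₁ hd'.symm ?_ ?_ (k₂.subset_and_nonempty_of_mem hA₁).1)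
    · rw [hU, Finset.union_comm]
    · rw [h, Finset.union_comm B₂, Finset.union_comm K₂]

theorem smul_node_eq {σ : Perm α} (h₁ : IsHierarchy A₁ H₁) (h₂ : IsHierarchy A₂ H₂)
    (hd : Disjoint A₁ A₂)
    (h : σ • insert (A₁ ∪ A₂) (H₁ ∪ H₂) = insert (A₁ ∪ A₂) (H₁ ∪ H₂)) :
    (σ • A₁ = A₁ ∧ σ • H₁ = H₁ ∧ σ • A₂ = A₂ ∧ σ • H₂ = H₂) ∨
      (σ • A₁ = A₂ ∧ σ • H₁ = H₂ ∧ σ • A₂ = A₁ ∧ σ • H₂ = H₁) := by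
  rw [Finset.smul_finset_insert, Finset.smul_finset_union, Finset.smul_finset_union] at h
  exact node_inj (h₁.smul σ) (h₂.smul σ) (disjoint_smul_finset σ hd) h₁ h₂ hd h

theorem exists_of_two_le_card (h : IsHierarchy A H) (hA : 2 ≤ A.card) :
    ∃ A₁ A₂ H₁ H₂, IsHierarchy A₁ H₁ ∧ IsHierarchy A₂ H₂ ∧ Disjoint A₁ A₂ ∧ A = A₁ ∪ A₂ ∧
      H = insert (A₁ ∪ A₂) (H₁ ∪ H₂) := by
  cases h with
  | leaf a => simp at hA
  | node h₁ h₂ hd => exact ⟨_, _, _, _, h₁, h₂, hd, rfl, rfl⟩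

theorem eq_singleton (h : IsHierarchy A H) (hA : A.card ≤ 1) : H = {A} := by
  cases h with
  | leaf a => rfl
  | node h₁ h₂ hd =>
    have := h₁.nonempty.card_pos
    have := h₂.nonempty.card_pos
    rw [Finset.card_union_of_disjoint hd] at hA
    omega

end IsHierarchy

/-- `A₁` is the label set of a branch at the root of the hierarchy `H` on `A`. -/
def IsBranch (A : Finset α) (H : Finset (Finset α)) (A₁ : Finset α) : Prop :=
  ∃ H₁ H₂, IsHierarchy A₁ H₁ ∧ IsHierarchy (A \ A₁) H₂ ∧ A₁ ⊆ A ∧ H = insert A (H₁ ∪ H₂)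

theorem isBranch_smul_eq {σ : Perm α} {A A₁ : Finset α} {H H₁ H₂ : Finset (Finset α)}
    (h₁ : IsHierarchy A₁ H₁) (h₂ : IsHierarchy (A \ A₁) H₂) (hs : A₁ ⊆ A)
    (hH : H = insert A (H₁ ∪ H₂)) (hσ : σ • H = H) :
    (σ • A₁ = A₁ ∧ σ • H₁ = H₁ ∧ σ • (A \ A₁) = A \ A₁ ∧ σ • H₂ = H₂) ∨
      (σ • A₁ = A \ A₁ ∧ σ • H₁ = H₂ ∧ σ • (A \ A₁) = A₁ ∧ σ • H₂ = H₁) := by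
  refine h₁.smul_node_eq h₂ Finset.disjoint_sdiff ?_
  rwa [Finset.union_sdiff_of_subset hs, ← hH]

theorem IsHierarchy.ne_sdiff {A A₁ : Finset α} {H₁ : Finset (Finset α)}
    (h₁ : IsHierarchy A₁ H₁) : A₁ ≠ A \ A₁ := by
  intro h
  obtain ⟨a, ha⟩ := h₁.nonempty
  have := h ▸ ha
  exact (Finset.mem_sdiff.1 this).2 ha

variable [Fintype α]

/-- The hierarchies with label set `A` that are fixed by `σ`. -/
noncomputable def fixedHierarchies (σ : Perm α) (A : Finset α) : Finset (Finset (Finset α)) :=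
  Finset.univ.filter fun H => IsHierarchy A H ∧ σ • H = H

theorem mem_fixedHierarchies {σ : Perm α} {A : Finset α} {H : Finset (Finset α)} :
    H ∈ fixedHierarchies σ A ↔ IsHierarchy A H ∧ σ • H = H := by
  simp [fixedHierarchies]

theorem card_isBranch_invSplits_le {σ : Perm α} {A A₁ : Finset α} (hA₁ : A₁ ∈ invSplits σ A) :
    ((fixedHierarchies σ A).filter fun H => IsBranch A H A₁).card ≤
      (fixedHierarchies σ A₁).card * (fixedHierarchies σ (A \ A₁)).card := by
  rw [← Finset.card_product]
  refine (Finset.card_le_card (t := ((fixedHierarchies σ A₁) ×ˢ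
    (fixedHierarchies σ (A \ A₁))).image fun p => insert A (p.1 ∪ p.2)) fun H hH => ?_).trans
    Finset.card_image_le
  rw [Finset.mem_filter, mem_fixedHierarchies] at hH
  obtain ⟨⟨-, hσ⟩, H₁, H₂, h₁, h₂, hs, hH⟩ := hH
  rcases isBranch_smul_eq h₁ h₂ hs hH hσ with ⟨-, e₁, -, e₂⟩ | ⟨e, -⟩
  · exact Finset.mem_image.2 ⟨(H₁, H₂), Finset.mem_product.2
      ⟨mem_fixedHierarchies.2 ⟨h₁, e₁⟩, mem_fixedHierarchies.2 ⟨h₂, e₂⟩⟩, hH.symm⟩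
  · exact absurd ((mem_invSplits.1 hA₁).2.2.symm.trans e) h₁.ne_sdiff

theorem card_isBranch_swapSplits_le {σ : Perm α} {A A₁ : Finset α} (hA₁ : A₁ ∈ swapSplits σ A) :
    ((fixedHierarchies σ A).filter fun H => IsBranch A H A₁).card ≤
      (fixedHierarchies (σ ^ 2) A₁).card := by
  refine (Finset.card_le_card (t := (fixedHierarchies (σ ^ 2) A₁).image
    fun K => insert A (K ∪ σ • K)) fun H hH => ?_).trans Finset.card_image_le
  rw [Finset.mem_filter, mem_fixedHierarchies] at hH
  obtain ⟨⟨-, hσ⟩, H₁, H₂, h₁, h₂, hs, hH⟩ := hH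
  rcases isBranch_smul_eq h₁ h₂ hs hH hσ with ⟨e, -⟩ | ⟨-, e₁, -, e₂⟩
  · exact absurd (e.symm.trans (mem_swapSplits.1 hA₁).2.2.1) h₁.ne_sdiff
  · refine Finset.mem_image.2 ⟨H₁, mem_fixedHierarchies.2 ⟨h₁, ?_⟩, ?_⟩
    · rw [pow_two, mul_smul, e₁, e₂]
    · rw [e₁, hH]

theorem two_le_card_isBranch {σ : Perm α} {A : Finset α} {H : Finset (Finset α)}
    (hA : 2 ≤ A.card) (hH : H ∈ fixedHierarchies σ A) :
    2 ≤ ((invSplits σ A ∪ swapSplits σ A).filter fun A₁ => IsBranch A H A₁).card := by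
  rw [mem_fixedHierarchies] at hH
  obtain ⟨A₁, A₂, H₁, H₂, h₁, h₂, hd, hAu, hHu⟩ := hH.1.exists_of_two_le_card hA
  have hA₂ : A₂ = A \ A₁ := hAu ▸ IsHierarchy.eq_sdiff_of_disjoint hd
  have hA₁ : A₁ = A \ A₂ := by
    rw [hAu, Finset.union_comm]
    exact IsHierarchy.eq_sdiff_of_disjoint hd.symm
  have key : ∀ {A₁ A₂ : Finset α} {H₁ H₂ : Finset (Finset α)}, IsHierarchy A₁ H₁ →
      IsHierarchy A₂ H₂ → A₂ = A \ A₁ → A₁ ⊆ A → H = insert A (H₁ ∪ H₂) →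
      A₁ ∈ (invSplits σ A ∪ swapSplits σ A).filter fun A₁ => IsBranch A H A₁ := by
    intro A₁ A₂ H₁ H₂ h₁ h₂ hA₂ hs hHu
    subst hA₂
    have hss : A₁ ⊂ A := ⟨hs, Finset.sdiff_nonempty.1 h₂.nonempty⟩
    refine Finset.mem_filter.2 ⟨?_, H₁, H₂, h₁, h₂, hs, hHu⟩
    rw [Finset.mem_union, mem_invSplits, mem_swapSplits]
    rcases isBranch_smul_eq h₁ h₂ hs hHu hH.2 with ⟨e, -⟩ | ⟨e, -, e', -⟩
    · exact Or.inl ⟨hss, h₁.nonempty, e⟩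
    · exact Or.inr ⟨hss, h₁.nonempty, e, e'⟩
  rw [← hAu] at hHu
  have hne : A₁ ≠ A₂ := hA₂ ▸ h₁.ne_sdiff
  rw [← Finset.card_pair hne]
  refine Finset.card_le_card (Finset.insert_subset_iff.2 ⟨?_, Finset.singleton_subset_iff.2 ?_⟩)
  · exact key h₁ h₂ hA₂ (hAu ▸ Finset.subset_union_left) hHu
  · exact key h₂ h₁ hA₁ (hAu ▸ Finset.subset_union_right) (by rw [hHu, Finset.union_comm])

theorem card_fixedHierarchies_le (σ : Perm α) (A : Finset α) :
    ((fixedHierarchies σ A).card : ℝ) ≤ treeCount σ A := by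
  induction hn : A.card using Nat.strong_induction_on generalizing σ A with
  | _ n ih =>
    subst hn
    by_cases hA : A.card ≤ 1
    · rw [treeCount_of_card_le_one hA]
      have : fixedHierarchies σ A ⊆ {{A}} := fun H hH =>
        Finset.mem_singleton.2 ((mem_fixedHierarchies.1 hH).1.eq_singleton hA)
      exact_mod_cast (Finset.card_le_card this).trans_eq (Finset.card_singleton _)
    have hA2 : 2 ≤ A.card := by omega
    have hdisj : Disjoint (invSplits σ A) (swapSplits σ A) := by
      rw [Finset.disjoint_left]
      intro A₁ h₁ h₂
      rw [mem_invSplits] at h₁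
      rw [mem_swapSplits] at h₂
      obtain ⟨a, ha⟩ := h₁.2.1
      have := h₁.2.2.symm.trans h₂.2.2.1 ▸ ha
      exact (Finset.mem_sdiff.1 this).2 ha
    have h₁ : 2 * (fixedHierarchies σ A).card ≤
        ∑ A₁ ∈ invSplits σ A, (fixedHierarchies σ A₁).card * (fixedHierarchies σ (A \ A₁)).card +
          ∑ A₁ ∈ swapSplits σ A, (fixedHierarchies (σ ^ 2) A₁).card := by
      calc 2 * (fixedHierarchies σ A).card
          = ∑ H ∈ fixedHierarchies σ A, 2 := by rw [Finset.sum_const, smul_eq_mul, mul_comm]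
        _ ≤ ∑ H ∈ fixedHierarchies σ A,
            ((invSplits σ A ∪ swapSplits σ A).filter fun A₁ => IsBranch A H A₁).card :=
          Finset.sum_le_sum fun H hH => two_le_card_isBranch hA2 hH
        _ = ∑ A₁ ∈ invSplits σ A ∪ swapSplits σ A,
            ((fixedHierarchies σ A).filter fun H => IsBranch A H A₁).card :=
          Finset.sum_card_bipartiteAbove_eq_sum_card_bipartiteBelow _
        _ ≤ _ := by
          rw [Finset.sum_union hdisj]
          exact add_le_add (Finset.sum_le_sum fun _ h => card_isBranch_invSplits_le h)
            (Finset.sum_le_sum fun _ h => card_isBranch_swapSplits_le h)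
    have h₂ : (2 : ℝ) * (fixedHierarchies σ A).card ≤ invSum σ A + swapSum σ A := by
      have h₁' := (Nat.cast_le (α := ℝ)).2 h₁
      push_cast at h₁'
      refine h₁'.trans (add_le_add (Finset.sum_le_sum fun A₁ h => ?_)
        (Finset.sum_le_sum fun A₁ h => ?_))
      · have h' := mem_invSplits.1 h
        exact mul_le_mul (ih _ (Finset.card_lt_card h'.1) _ _ rfl)
          (ih _ (Finset.card_lt_card (Finset.sdiff_ssubset h'.1.1 h'.2.1)) _ _ rfl)
          (Nat.cast_nonneg _) (treeCount_nonneg _ _)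
      · exact ih _ (Finset.card_lt_card (mem_swapSplits.1 h).1) _ _ rfl
    linarith [two_mul_treeCount (σ := σ) hA2]

end Hierarchy

section IsoFuns

theorem size_pos (T : PTree) : 0 < T.size := by
  induction T with
  | leaf => exact Nat.one_pos
  | node l r ihl _ => exact Nat.add_pos_left ihl _

theorem isoFuns_leaf_node (l r : PTree) : isoFuns leaf (node l r) = [] := by rw [isoFuns] <;> simp

theorem isoFuns_node_leaf (l r : PTree) : isoFuns (node l r) leaf = [] := by rw [isoFuns] <;> simp

theorem mem_isoFuns_leaf {φ : ℕ → ℕ} : φ ∈ isoFuns leaf leaf ↔ φ = id := by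
  rw [isoFuns, List.mem_singleton]
  rfl

theorem mem_isoFuns_node {l r l' r' : PTree} {φ : ℕ → ℕ} :
    φ ∈ isoFuns (node l r) (node l' r') ↔
      (∃ g ∈ isoFuns l l', ∃ h ∈ isoFuns r r',
        (fun i => if i < l.size then g i else h (i - l.size) + l'.size) = φ) ∨
      ∃ g ∈ isoFuns l r', ∃ h ∈ isoFuns r l',
        (fun i => if i < l.size then g i + l'.size else h (i - l.size)) = φ := by
  rw [isoFuns, List.mem_append, List.mem_flatMap, List.mem_flatMap]
  simp only [List.mem_map]

theorem size_eq_of_mem_isoFuns {T T' : PTree} {φ : ℕ → ℕ} (h : φ ∈ isoFuns T T') :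
    T.size = T'.size := by
  induction T generalizing T' φ with
  | leaf =>
    cases T' with
    | leaf => rfl
    | node l' r' => simp [isoFuns_leaf_node] at h
  | node l r ihl ihr =>
    cases T' with
    | leaf => simp [isoFuns_node_leaf] at h
    | node l' r' =>
      rw [size, size]
      rcases mem_isoFuns_node.1 h with ⟨g, hg, k, hk, -⟩ | ⟨g, hg, k, hk, -⟩
      · rw [ihl hg, ihr hk]
      · rw [ihl hg, ihr hk, add_comm]

theorem lt_size_of_mem_isoFuns {T T' : PTree} {φ : ℕ → ℕ} (h : φ ∈ isoFuns T T') {i : ℕ}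
    (hi : i < T.size) : φ i < T'.size := by
  induction T generalizing T' φ i with
  | leaf =>
    cases T' with
    | leaf => rwa [mem_isoFuns_leaf.1 h]
    | node l' r' => simp [isoFuns_leaf_node] at h
  | node l r ihl ihr =>
    cases T' with
    | leaf => simp [isoFuns_node_leaf] at h
    | node l' r' =>
      rw [size] at hi ⊢
      rcases mem_isoFuns_node.1 h with ⟨g, hg, k, hk, rfl⟩ | ⟨g, hg, k, hk, rfl⟩
      all_goals
        dsimp only
        split_ifs with hil
        · have := ihl hg hil
          omega
        · have := ihr hk (i := i - l.size) (by omega)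
          omega

theorem exists_of_mem_isoFuns {T T' : PTree} {φ : ℕ → ℕ} (h : φ ∈ isoFuns T T') {j : ℕ}
    (hj : j < T'.size) : ∃ i < T.size, φ i = j := by
  induction T generalizing T' φ j with
  | leaf =>
    cases T' with
    | leaf => exact ⟨j, hj, by rw [mem_isoFuns_leaf.1 h, id]⟩
    | node l' r' => simp [isoFuns_leaf_node] at h
  | node l r ihl ihr =>
    cases T' with
    | leaf => simp [isoFuns_node_leaf] at h
    | node l' r' =>
      rw [size] at hj ⊢
      rcases mem_isoFuns_node.1 h with ⟨g, hg, k, hk, rfl⟩ | ⟨g, hg, k, hk, rfl⟩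
      · by_cases hjl : j < l'.size
        · obtain ⟨i, hi, rfl⟩ := ihl hg hjl
          exact ⟨i, by omega, if_pos hi⟩
        · obtain ⟨i, hi, hij⟩ := ihr hk (j := j - l'.size) (by omega)
          refine ⟨i + l.size, by omega, ?_⟩
          dsimp only
          rw [if_neg (by omega), Nat.add_sub_cancel, hij]
          omega
      · by_cases hjl : j < l'.size
        · obtain ⟨i, hi, rfl⟩ := ihr hk hjl
          refine ⟨i + l.size, by omega, ?_⟩
          dsimp only
          rw [if_neg (by omega), Nat.add_sub_cancel]
        · obtain ⟨i, hi, hij⟩ := ihl hg (j := j - l'.size) (by omega)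
          refine ⟨i, by omega, ?_⟩
          dsimp only
          rw [if_pos hi, hij]
          omega

end IsoFuns

section LabelledTrees

open scoped Pointwise
open Equiv (Perm)

variable {α : Type*}

theorem injOn_left {l r : PTree} {f : ℕ → α} (hf : Set.InjOn f (Set.Iio (node l r).size)) :
    Set.InjOn f (Set.Iio l.size) :=
  hf.mono (Set.Iio_subset_Iio (Nat.le_add_right _ _))

theorem injOn_right {l r : PTree} {f : ℕ → α} (hf : Set.InjOn f (Set.Iio (node l r).size)) :
    Set.InjOn (fun i => f (i + l.size)) (Set.Iio r.size) := by
  intro i hi j hj h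
  rw [Set.mem_Iio] at hi hj
  rw [size] at hf
  exact Nat.add_right_cancel (hf (Set.mem_Iio.2 (by omega)) (Set.mem_Iio.2 (by omega)) h)

variable [DecidableEq α]

/-- The set of labels of the leaves of `T`, where the `i`-th leaf is labelled by `f i`. -/
def labels (T : PTree) (f : ℕ → α) : Finset α := (Finset.range T.size).image f

/-- The set of the label sets of the fringe subtrees of `T`, where the `i`-th leaf is labelled by
`f i`. -/
def hierarchy : PTree → (ℕ → α) → Finset (Finset α)
  | leaf, f => {{f 0}}
  | node l r, f =>
      insert (labels l f ∪ labels r fun i => f (i + l.size))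
        (hierarchy l f ∪ hierarchy r fun i => f (i + l.size))

theorem mem_labels {T : PTree} {f : ℕ → α} {a : α} : a ∈ labels T f ↔ ∃ i < T.size, f i = a := by
  simp [labels]

theorem labels_leaf (f : ℕ → α) : labels leaf f = {f 0} := by
  rw [labels, size, Finset.range_one, Finset.image_singleton]

theorem labels_node (l r : PTree) (f : ℕ → α) :
    labels (node l r) f = labels l f ∪ labels r fun i => f (i + l.size) := by
  ext a
  rw [Finset.mem_union, mem_labels, mem_labels, mem_labels, size]
  constructor
  · rintro ⟨i, hi, rfl⟩
    by_cases hil : i < l.size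
    · exact Or.inl ⟨i, hil, rfl⟩
    · exact Or.inr ⟨i - l.size, by omega, by rw [Nat.sub_add_cancel (not_lt.1 hil)]⟩
  · rintro (⟨i, hi, rfl⟩ | ⟨i, hi, rfl⟩)
    · exact ⟨i, by omega, rfl⟩
    · exact ⟨i + l.size, by omega, rfl⟩

theorem card_labels {T : PTree} {f : ℕ → α} (hf : Set.InjOn f (Set.Iio T.size)) :
    (labels T f).card = T.size := by
  rw [labels, Finset.card_image_of_injOn (by simpa using hf), Finset.card_range]

theorem disjoint_labels {l r : PTree} {f : ℕ → α} (hf : Set.InjOn f (Set.Iio (node l r).size)) :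
    Disjoint (labels l f) (labels r fun i => f (i + l.size)) := by
  rw [Finset.disjoint_left]
  intro a ha ha'
  obtain ⟨i, hi, rfl⟩ := mem_labels.1 ha
  obtain ⟨j, hj, h⟩ := mem_labels.1 ha'
  rw [size] at hf
  have := hf (Set.mem_Iio.2 (by omega)) (Set.mem_Iio.2 (by omega)) h
  omega

theorem isHierarchy_hierarchy {T : PTree} {f : ℕ → α} (hf : Set.InjOn f (Set.Iio T.size)) :
    IsHierarchy (labels T f) (hierarchy T f) := by
  induction T generalizing f with
  | leaf =>
    rw [labels_leaf, hierarchy]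
    exact .leaf _
  | node l r ihl ihr =>
    rw [labels_node, hierarchy]
    exact .node (ihl (injOn_left hf)) (ihr (injOn_right hf)) (disjoint_labels hf)

theorem smul_labels (σ : Perm α) (T : PTree) (f : ℕ → α) :
    σ • labels T f = labels T fun i => σ (f i) :=
  Finset.image_image

theorem smul_hierarchy (σ : Perm α) (T : PTree) (f : ℕ → α) :
    σ • hierarchy T f = hierarchy T fun i => σ (f i) := by
  induction T generalizing f with
  | leaf => simp only [hierarchy, Finset.smul_finset_singleton, Perm.smul_def]
  | node l r ihl ihr =>
    simp only [hierarchy, Finset.smul_finset_insert, Finset.smul_finset_union, ihl, ihr,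
      smul_labels]

theorem labels_eq_of_mem_isoFuns {T T' : PTree} {f f' : ℕ → α} {φ : ℕ → ℕ} (h : φ ∈ isoFuns T T')
    (hφ : ∀ i < T.size, f' (φ i) = f i) : labels T f = labels T' f' := by
  ext a
  rw [mem_labels, mem_labels]
  constructor
  · rintro ⟨i, hi, rfl⟩
    exact ⟨φ i, lt_size_of_mem_isoFuns h hi, hφ i hi⟩
  · rintro ⟨j, hj, rfl⟩
    obtain ⟨i, hi, rfl⟩ := exists_of_mem_isoFuns h hj
    exact ⟨i, hi, (hφ i hi).symm⟩

theorem hierarchy_eq_of_mem_isoFuns {T T' : PTree} {f f' : ℕ → α} {φ : ℕ → ℕ}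
    (h : φ ∈ isoFuns T T') (hφ : ∀ i < T.size, f' (φ i) = f i) :
    hierarchy T f = hierarchy T' f' := by
  induction T generalizing T' f f' φ with
  | leaf =>
    cases T' with
    | leaf =>
      rw [hierarchy, hierarchy, ← hφ 0 Nat.one_pos, mem_isoFuns_leaf.1 h, id]
    | node l' r' => simp [isoFuns_leaf_node] at h
  | node l r ihl ihr =>
    cases T' with
    | leaf => simp [isoFuns_node_leaf] at h
    | node l' r' =>
      rw [hierarchy, hierarchy, ← labels_node, ← labels_node, labels_eq_of_mem_isoFuns h hφ]
      rw [size] at hφ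
      rcases mem_isoFuns_node.1 h with ⟨g, hg, k, hk, rfl⟩ | ⟨g, hg, k, hk, rfl⟩
      · dsimp only at hφ
        rw [ihl hg (f' := f') fun i hi => ?_,
          ihr hk (f' := fun i => f' (i + l'.size)) fun i hi => ?_]
        · have := hφ (i + l.size) (by omega)
          rwa [if_neg (by omega), Nat.add_sub_cancel] at this
        · have := hφ i (by omega)
          rwa [if_pos hi] at this
      · dsimp only at hφ
        rw [ihl hg (f' := fun i => f' (i + l'.size)) fun i hi => ?_,
          ihr hk (f' := f') fun i hi => ?_, Finset.union_comm]
        · have := hφ (i + l.size) (by omega)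
          rwa [if_neg (by omega), Nat.add_sub_cancel] at this
        · have := hφ i (by omega)
          rwa [if_pos hi] at this

theorem exists_isoFuns_of_hierarchy_eq {T T' : PTree} {f f' : ℕ → α}
    (hf : Set.InjOn f (Set.Iio T.size)) (hf' : Set.InjOn f' (Set.Iio T'.size))
    (h : hierarchy T f = hierarchy T' f') :
    ∃ φ ∈ isoFuns T T', ∀ i < T.size, f' (φ i) = f i := by
  have hsize : T.size = T'.size := by
    rw [← card_labels hf, ← card_labels hf',
      (isHierarchy_hierarchy hf).eq_of_eq (h ▸ isHierarchy_hierarchy hf')]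
  induction T generalizing T' f f' with
  | leaf =>
    cases T' with
    | leaf =>
      refine ⟨id, mem_isoFuns_leaf.2 rfl, fun i hi => ?_⟩
      rw [hierarchy, hierarchy, Finset.singleton_inj, Finset.singleton_inj] at h
      rw [size, Nat.lt_one_iff] at hi
      rw [hi, id, h]
    | node l' r' =>
      have := l'.size_pos
      have := r'.size_pos
      rw [size, size] at hsize
      omega
  | node l r ihl ihr =>
    cases T' with
    | leaf =>
      have := l.size_pos
      have := r.size_pos
      rw [size, size] at hsize
      omega
    | node l' r' =>
      rw [hierarchy, hierarchy] at h
      have hcard : ∀ {T T' : PTree} {f f' : ℕ → α}, Set.InjOn f (Set.Iio T.size) →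
          Set.InjOn f' (Set.Iio T'.size) → labels T f = labels T' f' → T.size = T'.size :=
        fun h h' e => by rw [← card_labels h, ← card_labels h', e]
      rcases IsHierarchy.node_inj (isHierarchy_hierarchy (injOn_left hf))
        (isHierarchy_hierarchy (injOn_right hf)) (disjoint_labels hf)
        (isHierarchy_hierarchy (injOn_left hf')) (isHierarchy_hierarchy (injOn_right hf'))
        (disjoint_labels hf') h with ⟨a₁, e₁, a₂, e₂⟩ | ⟨a₁, e₁, a₂, e₂⟩
      · obtain ⟨g, hg, hg'⟩ := ihl (injOn_left hf) (injOn_left hf') e₁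
          (hcard (injOn_left hf) (injOn_left hf') a₁)
        obtain ⟨k, hk, hk'⟩ := ihr (injOn_right hf) (injOn_right hf') e₂
          (hcard (injOn_right hf) (injOn_right hf') a₂)
        refine ⟨_, mem_isoFuns_node.2 (Or.inl ⟨g, hg, k, hk, rfl⟩), fun i hi => ?_⟩
        rw [size] at hi
        split_ifs with hil
        · exact hg' i hil
        · rw [hk' _ (by omega), Nat.sub_add_cancel (not_lt.1 hil)]
      · obtain ⟨g, hg, hg'⟩ := ihl (injOn_left hf) (injOn_right hf') e₁
          (hcard (injOn_left hf) (injOn_right hf') a₁)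
        obtain ⟨k, hk, hk'⟩ := ihr (injOn_right hf) (injOn_left hf') e₂
          (hcard (injOn_right hf) (injOn_left hf') a₂)
        refine ⟨_, mem_isoFuns_node.2 (Or.inr ⟨g, hg, k, hk, rfl⟩), fun i hi => ?_⟩
        rw [size] at hi
        split_ifs with hil
        · exact hg' i hil
        · rw [hk' _ (by omega), Nat.sub_add_cancel (not_lt.1 hil)]

end LabelledTrees

section Triples

theorem mem_planeTrees {n : ℕ} {T : PTree} : T ∈ planeTrees n ↔ T.size = n := by
  induction n using planeTrees.induct generalizing T with
  | case1 => simpa [planeTrees] using T.size_pos.ne'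
  | case2 =>
    rw [planeTrees, Finset.mem_singleton]
    cases T with
    | leaf => simp [size]
    | node l r =>
      have := l.size_pos
      have := r.size_pos
      simp only [reduceCtorEq, size, false_iff]
      omega
  | case3 n ih₁ ih₂ =>
    rw [planeTrees]
    simp only [Finset.mem_biUnion, Finset.mem_attach, true_and, Finset.mem_image,
      Finset.mem_product, Prod.exists]
    cases T with
    | leaf => simp [size]
    | node l r =>
      have hl := l.size_pos
      have hr := r.size_pos
      rw [size]
      constructor
      · rintro ⟨k, l', r', ⟨h₁, h₂⟩, h⟩
        obtain ⟨rfl, rfl⟩ := node.inj h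
        rw [ih₁] at h₁
        rw [ih₂] at h₂
        have := Finset.mem_range.1 k.2
        omega
      · intro h
        refine ⟨⟨l.size - 1, Finset.mem_range.2 (by omega)⟩, l, r, ⟨?_, ?_⟩, rfl⟩
        · rw [ih₁]
          dsimp only
          omega
        · rw [ih₂]
          dsimp only
          omega

theorem mem_Triples {n : ℕ} {t : PTree × PTree × List ℕ} :
    t ∈ Triples n ↔ t.1.size = n ∧ t.2.1.size = n ∧ t.2.2.Perm (List.range n) := by
  rw [Triples, Finset.mem_product, Finset.mem_product, mem_planeTrees, mem_planeTrees,
    List.mem_toFinset, List.mem_permutations]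

theorem equivTriple_iff {n : ℕ} {t t' : PTree × PTree × List ℕ} :
    equivTriple n t t' = true ↔ ∃ φ ∈ isoFuns t.1 t'.1, ∃ ψ ∈ isoFuns t.2.1 t'.2.1,
      ∀ i < n, t'.2.2.getD (φ i) 0 = ψ (t.2.2.getD i 0) := by
  simp only [equivTriple, List.any_eq_true, List.all_eq_true, List.mem_range, beq_iff_eq]

variable {n : ℕ} {v : List ℕ}

theorem getD_lt (hv : v.Perm (List.range n)) {i : ℕ} (hi : i < n) : v.getD i 0 < n := by
  have hlen : v.length = n := by rw [hv.length_eq, List.length_range]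
  rw [List.getD_eq_getElem _ _ (hlen ▸ hi), ← List.mem_range, ← hv.mem_iff]
  exact List.getElem_mem _

theorem injOn_getD (hv : v.Perm (List.range n)) :
    Set.InjOn (fun i => v.getD i 0) (Set.Iio n) := by
  have hlen : v.length = n := by rw [hv.length_eq, List.length_range]
  intro i hi j hj h
  rw [Set.mem_Iio, ← hlen] at hi hj
  dsimp only at h
  rw [List.getD_eq_getElem _ _ hi, List.getD_eq_getElem _ _ hj] at h
  exact (hv.nodup_iff.2 List.nodup_range).getElem_inj_iff.1 h

theorem eq_of_getD_eq {w : List ℕ} (hv : v.Perm (List.range n)) (hw : w.Perm (List.range n))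
    (h : ∀ i < n, v.getD i 0 = w.getD i 0) : v = w := by
  have hv' : v.length = n := by rw [hv.length_eq, List.length_range]
  have hw' : w.length = n := by rw [hw.length_eq, List.length_range]
  refine List.ext_getElem (hv'.trans hw'.symm) fun i hi hi' => ?_
  rw [← List.getD_eq_getElem v 0 hi, ← List.getD_eq_getElem w 0 hi', h i (hv' ▸ hi)]

end Triples

section Burnside

open scoped Pointwise
open Equiv (Perm)

/-- The pair of hierarchies of a triple, where the matching is used to label both trees. -/
def hierarchyPair (n : ℕ) [NeZero n] (t : PTree × PTree × List ℕ) :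
    Finset (Finset (Fin n)) × Finset (Finset (Fin n)) :=
  (hierarchy t.1 fun i => Fin.ofNat n (t.2.2.getD i 0), hierarchy t.2.1 fun i => Fin.ofNat n i)

variable {n : ℕ} [NeZero n]

theorem injOn_ofNat : Set.InjOn (Fin.ofNat n) (Set.Iio n) := by
  intro i hi j hj h
  have := Fin.val_eq_of_eq h
  rwa [Fin.val_ofNat, Fin.val_ofNat, Nat.mod_eq_of_lt hi, Nat.mod_eq_of_lt hj] at this

theorem injOn_ofNat_getD {v : List ℕ} (hv : v.Perm (List.range n)) :
    Set.InjOn (fun i => Fin.ofNat n (v.getD i 0)) (Set.Iio n) :=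
  injOn_ofNat.comp (injOn_getD hv) fun _ hi => getD_lt hv hi

theorem isHierarchy_univ {T : PTree} {f : ℕ → Fin n} (hT : T.size = n)
    (hf : Set.InjOn f (Set.Iio n)) : IsHierarchy Finset.univ (hierarchy T f) := by
  subst hT
  rw [← Finset.eq_univ_of_card (labels T f) ((card_labels hf).trans (Fintype.card_fin _).symm)]
  exact isHierarchy_hierarchy hf

theorem exists_perm_of_mem_isoFuns {T T' : PTree} {ψ : ℕ → ℕ} (hT : T.size = n)
    (hψ : ψ ∈ isoFuns T T') :
    ∃ σ : Perm (Fin n), ∀ i < n, σ (Fin.ofNat n i) = Fin.ofNat n (ψ i) := by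
  have hs : Function.Surjective fun x : Fin n => Fin.ofNat n (ψ x) := by
    intro y
    obtain ⟨i, hi, hiy⟩ := exists_of_mem_isoFuns hψ (j := y)
      (by rw [← size_eq_of_mem_isoFuns hψ, hT]; exact y.2)
    refine ⟨⟨i, hT ▸ hi⟩, ?_⟩
    dsimp only
    rw [hiy, Fin.ofNat_val_eq_self]
  refine ⟨Equiv.ofBijective _ (Finite.injective_iff_surjective.2 hs |>.bijective_of_finite),
    fun i hi => ?_⟩
  rw [Equiv.ofBijective_apply, Fin.val_ofNat, Nat.mod_eq_of_lt hi]

theorem equivTriple_iff_exists_smul {t t' : PTree × PTree × List ℕ} (ht : t ∈ Triples n)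
    (ht' : t' ∈ Triples n) :
    equivTriple n t t' = true ↔ ∃ σ : Perm (Fin n), σ • hierarchyPair n t = hierarchyPair n t' := by
  obtain ⟨h₁, h₂, hv⟩ := mem_Triples.1 ht
  obtain ⟨h₁', h₂', hv'⟩ := mem_Triples.1 ht'
  rw [equivTriple_iff]
  constructor
  · rintro ⟨φ, hφ, ψ, hψ, h⟩
    obtain ⟨σ, hσ⟩ := exists_perm_of_mem_isoFuns h₂ hψ
    refine ⟨σ, Prod.ext ?_ ?_⟩
    · refine (smul_hierarchy _ _ _).trans (hierarchy_eq_of_mem_isoFuns hφ fun i hi => ?_)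
      rw [h₁] at hi
      rw [hσ _ (getD_lt hv hi), h i hi]
    · refine (smul_hierarchy _ _ _).trans (hierarchy_eq_of_mem_isoFuns hψ fun i hi => ?_)
      rw [hσ _ (h₂ ▸ hi)]
  · rintro ⟨σ, hσ⟩
    have e₁ := (smul_hierarchy σ _ _).symm.trans (congrArg Prod.fst hσ)
    have e₂ := (smul_hierarchy σ _ _).symm.trans (congrArg Prod.snd hσ)
    obtain ⟨φ, hφ, hφ'⟩ := exists_isoFuns_of_hierarchy_eq
      (by rw [h₁]; exact σ.injective.comp_injOn (injOn_ofNat_getD hv))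
      (by rw [h₁']; exact injOn_ofNat_getD hv') e₁
    obtain ⟨ψ, hψ, hψ'⟩ := exists_isoFuns_of_hierarchy_eq
      (by rw [h₂]; exact σ.injective.comp_injOn injOn_ofNat)
      (by rw [h₂']; exact injOn_ofNat) e₂
    refine ⟨φ, hφ, ψ, hψ, fun i hi => injOn_ofNat (n := n) ?_ ?_ ?_⟩
    · exact getD_lt hv' (h₁' ▸ lt_size_of_mem_isoFuns hφ (h₁ ▸ hi))
    · exact Set.mem_Iio.2 (h₂'.symm ▸ lt_size_of_mem_isoFuns hψ (h₂.symm ▸ getD_lt hv hi))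
    · rw [hφ' i (h₁ ▸ hi), hψ' _ (h₂.symm ▸ getD_lt hv hi)]

theorem equivTriple_self {n : ℕ} {t : PTree × PTree × List ℕ} (ht : t ∈ Triples n) :
    equivTriple n t t = true := by
  have : NeZero n := ⟨(mem_Triples.1 ht).1 ▸ t.1.size_pos.ne'⟩
  exact (equivTriple_iff_exists_smul ht ht).2 ⟨1, one_smul _ _⟩

/-- Pairs of hierarchies with label set `α`. -/
def HierarchyPair (α : Type*) [Fintype α] [DecidableEq α] : Type _ :=
  {p : Finset (Finset α) × Finset (Finset α) //
    IsHierarchy Finset.univ p.1 ∧ IsHierarchy Finset.univ p.2}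

noncomputable instance (α : Type*) [Fintype α] [DecidableEq α] : Fintype (HierarchyPair α) :=
  inferInstanceAs (Fintype {p : Finset (Finset α) × Finset (Finset α) //
    IsHierarchy Finset.univ p.1 ∧ IsHierarchy Finset.univ p.2})

instance (α : Type*) [Fintype α] [DecidableEq α] : MulAction (Perm α) (HierarchyPair α) where
  smul σ p := ⟨σ • p.1, by
    have h₁ := p.2.1.smul σ
    have h₂ := p.2.2.smul σ
    rw [Finset.smul_finset_univ] at h₁ h₂
    exact ⟨h₁, h₂⟩⟩
  one_smul p := Subtype.ext (one_smul _ p.1)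
  mul_smul σ τ p := Subtype.ext (mul_smul σ τ p.1)

theorem card_fixedBy_le {α : Type*} [Fintype α] [DecidableEq α] (σ : Perm α) :
    Fintype.card (MulAction.fixedBy (HierarchyPair α) σ) ≤
      (fixedHierarchies σ Finset.univ).card ^ 2 := by
  rw [pow_two, ← Finset.card_product, ← Fintype.card_coe]
  have h : ∀ p : MulAction.fixedBy (HierarchyPair α) σ, σ • p.1.1 = p.1.1 := fun p =>
    congrArg Subtype.val p.2
  refine Fintype.card_le_of_injective (fun p => ⟨p.1.1, Finset.mem_product.2
    ⟨mem_fixedHierarchies.2 ⟨p.1.2.1, congrArg Prod.fst (h p)⟩,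
      mem_fixedHierarchies.2 ⟨p.1.2.2, congrArg Prod.snd (h p)⟩⟩⟩) fun p q hpq => ?_
  exact Subtype.ext (Subtype.ext (Subtype.mk.inj hpq))

theorem card_orbits_mul_factorial_le {α : Type*} [Fintype α] [DecidableEq α] [Nonempty α] :
    (Fintype.card (MulAction.orbitRel.Quotient (Perm α) (HierarchyPair α)) : ℝ) *
      (Fintype.card α).factorial ≤ 3 * labelledCount (Fintype.card α) ^ 2 := by
  have h := MulAction.sum_card_fixedBy_eq_card_orbits_mul_card_group (Perm α) (HierarchyPair α)
  rw [Fintype.card_perm] at h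
  calc _ = ∑ σ : Perm α, (Fintype.card (MulAction.fixedBy (HierarchyPair α) σ) : ℝ) := by
        exact_mod_cast h.symm
    _ ≤ ∑ σ : Perm α, treeCount σ Finset.univ ^ 2 := Finset.sum_le_sum fun σ _ => by
        refine (Nat.cast_le.2 (card_fixedBy_le σ)).trans ?_
        push_cast
        exact pow_le_pow_left₀ (Nat.cast_nonneg _) (card_fixedHierarchies_le σ _) 2
    _ ≤ _ := sum_treeCount_univ_sq_le

theorem numTanglegrams_le_card_orbits :
    numTanglegrams n ≤
      Fintype.card (MulAction.orbitRel.Quotient (Perm (Fin n)) (HierarchyPair (Fin n))) := by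
  rw [numTanglegrams, ← Finset.card_univ]
  refine Finset.card_le_card_of_forall_subsingleton (fun c q => ∃ t ∈ Triples n,
    (Triples n).filter (fun t' => equivTriple n t t' = true) = c ∧
      ∃ p : HierarchyPair (Fin n), p.1 = hierarchyPair n t ∧
        (Quotient.mk _ p : MulAction.orbitRel.Quotient (Perm (Fin n)) _) = q) ?_ ?_
  · intro c hc
    obtain ⟨t, ht, rfl⟩ := Finset.mem_image.1 hc
    obtain ⟨h₁, h₂, hv⟩ := mem_Triples.1 ht
    exact ⟨_, Finset.mem_univ _, t, ht, rfl, ⟨hierarchyPair n t,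
      isHierarchy_univ h₁ (injOn_ofNat_getD hv), isHierarchy_univ h₂ injOn_ofNat⟩, rfl, rfl⟩
  · rintro q - c ⟨-, t, ht, rfl, p, hp, rfl⟩ d ⟨-, t', ht', rfl, p', hp', h⟩
    obtain ⟨σ, hσ⟩ := MulAction.orbitRel_apply.1 (Quotient.exact h)
    have hσ' : σ • hierarchyPair n t = hierarchyPair n t' := by
      rw [← hp, ← hp', ← hσ]
      rfl
    refine Finset.filter_congr fun u hu => ?_
    rw [equivTriple_iff_exists_smul ht hu, equivTriple_iff_exists_smul ht' hu, ← hσ']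
    constructor
    · rintro ⟨τ, hτ⟩
      exact ⟨τ * σ⁻¹, by rw [mul_smul, inv_smul_smul, hτ]⟩
    · rintro ⟨τ, hτ⟩
      exact ⟨τ * σ, by rw [mul_smul, hτ]⟩

theorem numTanglegrams_mul_factorial_le :
    (numTanglegrams n : ℝ) * n.factorial ≤ 3 * labelledCount n ^ 2 := by
  have h := card_orbits_mul_factorial_le (α := Fin n)
  rw [Fintype.card_fin] at h
  exact (mul_le_mul_of_nonneg_right (Nat.cast_le.2 numTanglegrams_le_card_orbits)
    (Nat.cast_nonneg _)).trans h

end Burnside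

section ClassSize

/-- The plane trees isomorphic to `T` obtained by flipping internal vertices of `T`, together with
the induced isomorphisms; every such tree with its isomorphism occurs. -/
def flips : PTree → List (PTree × (ℕ → ℕ))
  | leaf => [(leaf, id)]
  | node l r =>
      ((flips l).flatMap fun p => (flips r).map fun q =>
        (node p.1 q.1, fun i => if i < l.size then p.2 i else q.2 (i - l.size) + p.1.size)) ++
      ((flips l).flatMap fun p => (flips r).map fun q =>
        (node q.1 p.1, fun i => if i < l.size then p.2 i + q.1.size else q.2 (i - l.size)))

theorem length_flips (T : PTree) : 2 * (flips T).length = 2 ^ T.size := by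
  induction T with
  | leaf => rfl
  | node l r ihl ihr =>
    rw [size, pow_add, ← ihl, ← ihr]
    simp [flips, List.length_flatMap]
    ring

theorem mem_flips {T T' : PTree} {φ : ℕ → ℕ} (h : φ ∈ isoFuns T T') : (T', φ) ∈ flips T := by
  induction T generalizing T' φ with
  | leaf =>
    cases T' with
    | leaf => simp [flips, mem_isoFuns_leaf.1 h]
    | node l' r' => simp [isoFuns_leaf_node] at h
  | node l r ihl ihr =>
    cases T' with
    | leaf => simp [isoFuns_node_leaf] at h
    | node l' r' =>
      rw [flips, List.mem_append, List.mem_flatMap, List.mem_flatMap]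
      rcases mem_isoFuns_node.1 h with ⟨g, hg, k, hk, rfl⟩ | ⟨g, hg, k, hk, rfl⟩
      · exact Or.inl ⟨_, ihl hg, List.mem_map.2 ⟨_, ihr hk, rfl⟩⟩
      · exact Or.inr ⟨_, ihl hg, List.mem_map.2 ⟨_, ihr hk, rfl⟩⟩

theorem card_class_le {n : ℕ} {t : PTree × PTree × List ℕ} (ht : t ∈ Triples n) :
    ((Triples n).filter fun t' => equivTriple n t t' = true).card ≤ 4 ^ (n - 1) := by
  obtain ⟨h₁, h₂, hv⟩ := mem_Triples.1 ht
  have hn : 2 ^ n = 2 * 2 ^ (n - 1) := by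
    rw [← pow_succ', Nat.sub_add_cancel (h₁ ▸ t.1.size_pos)]
  have hlen : ∀ {T : PTree}, T.size = n → (flips T).toFinset.card ≤ 2 ^ (n - 1) := fun {T} hT => by
    have := length_flips T
    rw [hT, hn] at this
    exact (List.toFinset_card_le _).trans (by omega)
  calc _ ≤ ((flips t.1).toFinset ×ˢ (flips t.2.1).toFinset).card := by
        refine Finset.card_le_card_of_forall_subsingleton (fun t' p => p.1.1 = t'.1 ∧
          p.2.1 = t'.2.1 ∧ p.1.2 ∈ isoFuns t.1 t'.1 ∧
          ∀ i < n, t'.2.2.getD (p.1.2 i) 0 = p.2.2 (t.2.2.getD i 0)) ?_ ?_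
        · intro t' ht'
          obtain ⟨φ, hφ, ψ, hψ, h⟩ := equivTriple_iff.1 (Finset.mem_filter.1 ht').2
          exact ⟨((t'.1, φ), t'.2.1, ψ), Finset.mem_product.2
            ⟨List.mem_toFinset.2 (mem_flips hφ), List.mem_toFinset.2 (mem_flips hψ)⟩,
            rfl, rfl, hφ, h⟩
        · rintro p - ⟨T, S, v⟩ ⟨htv, e₁, e₂, hφ, hp⟩ ⟨T', S', v'⟩ ⟨htv', e₁', e₂', -, hp'⟩
          obtain ⟨hT, -, hv⟩ := mem_Triples.1 (Finset.mem_filter.1 htv).1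
          obtain ⟨-, -, hv'⟩ := mem_Triples.1 (Finset.mem_filter.1 htv').1
          dsimp only at *
          rw [← e₁, ← e₂, ← e₁', ← e₂', eq_of_getD_eq hv hv' fun j hj => ?_]
          obtain ⟨i, hi, rfl⟩ := exists_of_mem_isoFuns hφ (hT.symm ▸ hj)
          rw [h₁] at hi
          rw [hp i hi, hp' i hi]
    _ ≤ 2 ^ (n - 1) * 2 ^ (n - 1) := by
        rw [Finset.card_product]
        exact Nat.mul_le_mul (hlen h₁) (hlen h₂)
    _ = 4 ^ (n - 1) := (mul_pow 2 2 (n - 1)).symm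

theorem card_filter_Triples_le {n : ℕ} (P : PTree × PTree × List ℕ → Prop) :
    ((Triples n).filter P).card ≤
      ((tangleClasses n).filter fun c => ∃ t ∈ c, P t).card * 4 ^ (n - 1) := by
  refine (Finset.card_le_card (t := ((tangleClasses n).filter fun c => ∃ t ∈ c, P t).biUnion id)
    fun t ht => ?_).trans (Finset.card_biUnion_le_card_mul _ _ _ fun c hc => ?_)
  · obtain ⟨ht, hP⟩ := Finset.mem_filter.1 ht
    have hmem : t ∈ (Triples n).filter fun t' => equivTriple n t t' = true :=
      Finset.mem_filter.2 ⟨ht, equivTriple_self ht⟩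
    exact Finset.mem_biUnion.2 ⟨_, Finset.mem_filter.2
      ⟨Finset.mem_image_of_mem _ ht, t, hmem, hP⟩, hmem⟩
  · obtain ⟨t, ht, rfl⟩ := Finset.mem_image.1 (Finset.mem_filter.1 hc).1
    exact card_class_le ht

theorem card_filter_pairs_mul_factorial_le {n : ℕ} (Q : PTree × PTree → Prop) :
    ((planeTrees n ×ˢ planeTrees n).filter Q).card * n.factorial ≤
      ((Triples n).filter fun t => Q (t.1, t.2.1)).card := by
  have hperm : (List.range n).permutations.toFinset.card = n.factorial := by
    rw [List.toFinset_card_of_nodup (List.nodup_permutations _ List.nodup_range),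
      List.length_permutations, List.length_range]
  rw [← hperm, ← Finset.card_product]
  refine Finset.card_le_card_of_injOn (fun x => (x.1.1, x.1.2, x.2)) ?_ ?_
  · rintro ⟨⟨T, S⟩, v⟩ h
    simp only [Finset.coe_product, Set.mem_prod, Finset.mem_coe, Finset.mem_filter,
      Finset.mem_product] at h
    simpa [Triples] using ⟨⟨h.1.1.1, h.1.1.2, by simpa using h.2⟩, h.1.2⟩
  · rintro ⟨⟨T, S⟩, v⟩ - ⟨⟨T', S'⟩, v'⟩ - h
    simp only [Prod.mk.injEq] at h ⊢
    tauto

end ClassSize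

section Catalan

/-- The plane binary tree whose internal vertices form the given tree. -/
def ofTree : BinaryTree Unit → PTree
  | .nil => leaf
  | .node _ l r => node (ofTree l) (ofTree r)

theorem size_ofTree (T : BinaryTree Unit) : (ofTree T).size = T.numNodes + 1 := by
  induction T with
  | nil => rfl
  | node a l r ihl ihr =>
    rw [ofTree, size, ihl, ihr, BinaryTree.numNodes]
    ring

theorem ofTree_injective : Function.Injective ofTree := by
  intro T T' h
  induction T generalizing T' with
  | nil => cases T' with
    | nil => rfl
    | node a l r => cases h
  | node a l r ihl ihr => cases T' with
    | nil => cases h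
    | node a' l' r' =>
      obtain ⟨h₁, h₂⟩ := node.inj h
      rw [ihl h₁, ihr h₂]

theorem catalan_le_card_planeTrees (n : ℕ) : catalan n ≤ (planeTrees (n + 1)).card := by
  rw [← BinaryTree.treesOfNumNodesEq_card_eq_catalan]
  refine Finset.card_le_card_of_injOn ofTree (fun T hT => ?_) ofTree_injective.injOn
  exact Finset.mem_coe.2 (mem_planeTrees.2
    (by rw [size_ofTree, BinaryTree.mem_treesOfNumNodesEq.1 hT]))

theorem labelledCount_mul_two_pow (n : ℕ) :
    labelledCount (n + 1) * 2 ^ n = (n + 1).factorial * catalan n := by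
  induction n with
  | zero => simp [labelledCount]
  | succ n ih =>
    have h₁ := succ_mul_catalan_eq_centralBinom n
    have h₂ := succ_mul_catalan_eq_centralBinom (n + 1)
    have h₃ := Nat.succ_mul_centralBinom_succ n
    have h : (n + 2) * catalan (n + 1) = 2 * (2 * n + 1) * catalan n := by
      refine Nat.eq_of_mul_eq_mul_left n.succ_pos ?_
      rw [Nat.succ_eq_add_one, h₂, h₃, ← h₁]
      ring
    have h' : ((n : ℝ) + 2) * catalan (n + 1) = 2 * (2 * n + 1) * catalan n := by exact_mod_cast h
    rw [labelledCount_succ (Nat.succ_pos n), Nat.factorial_succ (n + 1), pow_succ]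
    push_cast
    linear_combination 2 * (2 * (n : ℝ) + 1) * ih - ((n + 1).factorial : ℝ) * h'

end Catalan

theorem nuP_le_three_mul_nuT {n : ℕ} (hn : 1 ≤ n) (S : Finset (PTree × PTree)) :
    nuP n S ≤ 3 * nuT n S := by
  have : NeZero n := ⟨Nat.one_le_iff_ne_zero.1 hn⟩
  obtain ⟨Q, hQ⟩ : ∃ Q : PTree × PTree → Prop, Q = fun p => (normalize p.1, normalize p.2) ∈ S :=
    ⟨_, rfl⟩
  set a := ((planeTrees n ×ˢ planeTrees n).filter Q).card with ha
  set b := ((tangleClasses n).filter fun c => ∃ t ∈ c, Q (t.1, t.2.1)).card with hb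
  have hP : nuP n S = a / ((planeTrees n).card ^ 2 : ℝ) := by
    simp only [nuP, ha, hQ]
  have hT : nuT n S = b / numTanglegrams n := by
    simp only [nuT, tangleProb, hb, hQ]
  have hab : (a : ℝ) * n.factorial ≤ b * 4 ^ (n - 1) := by
    have h : a * n.factorial ≤ b * 4 ^ (n - 1) :=
      (card_filter_pairs_mul_factorial_le Q).trans (card_filter_Triples_le _)
    exact_mod_cast h
  have htn := numTanglegrams_mul_factorial_le (n := n)
  obtain ⟨m, rfl⟩ : ∃ m, n = m + 1 := ⟨n - 1, by omega⟩
  have hcat : (catalan m : ℝ) ≤ (planeTrees (m + 1)).card := by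
    exact_mod_cast catalan_le_card_planeTrees m
  have hL := labelledCount_mul_two_pow m
  have hLpos := labelledCount_pos (m + 1)
  have hf : (0 : ℝ) < (m + 1).factorial := by exact_mod_cast Nat.factorial_pos _
  have hcpos : (0 : ℝ) < catalan m := by
    have : 0 < labelledCount (m + 1) * 2 ^ m := by positivity
    rw [hL] at this
    exact pos_of_mul_pos_right this hf.le
  have hpos : (0 : ℝ) < (planeTrees (m + 1)).card := hcpos.trans_le hcat
  have htpos : (0 : ℝ) < numTanglegrams (m + 1) := by
    obtain ⟨T, hT⟩ := Finset.card_pos.1 (Nat.cast_pos.1 hpos)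
    have hmem : (T, T, List.range (m + 1)) ∈ Triples (m + 1) :=
      mem_Triples.2 ⟨mem_planeTrees.1 hT, mem_planeTrees.1 hT, List.Perm.refl _⟩
    exact Nat.cast_pos.2 (Finset.card_pos.2 ⟨_, Finset.mem_image_of_mem _ hmem⟩)
  rw [hP, hT, mul_div_assoc', div_le_div_iff₀ (by positivity) htpos]
  rw [Nat.add_sub_cancel] at hab
  set c := ((planeTrees (m + 1)).card : ℝ)
  set F := ((m + 1).factorial : ℝ)
  set L := labelledCount (m + 1)
  have h4 : (4 : ℝ) ^ m = 2 ^ m * 2 ^ m := by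
    rw [← mul_pow]
    norm_num
  have hLc : L * 2 ^ m ≤ F * c := hL.trans_le (mul_le_mul_of_nonneg_left hcat hf.le)
  have hLc2 : (L * 2 ^ m) ^ 2 ≤ (F * c) ^ 2 := pow_le_pow_left₀ (by positivity) hLc 2
  refine le_of_mul_le_mul_right ?_ (mul_pos hf hf)
  calc (a : ℝ) * numTanglegrams (m + 1) * (F * F)
      = a * F * (numTanglegrams (m + 1) * F) := by ring
    _ ≤ b * 4 ^ m * (3 * L ^ 2) := mul_le_mul hab htn (by positivity) (by positivity)
    _ = 3 * b * (L * 2 ^ m) ^ 2 := by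
        rw [h4]
        ring
    _ ≤ 3 * b * (F * c) ^ 2 := by gcongr
    _ = 3 * b * c ^ 2 * (F * F) := by ring

end PTree

open PTree in
/-- Theorem 1 (second part, second inequality): there is a positive constant `M₂` with
`νP_n(S) ≤ M₂ · νT_n(S) + O(n⁻¹)` for every subset `S` of `B_n × B_n`,
the `O`-constant being absolute. -/
theorem nuP_le_mul_nuT_add :
    ∃ M₂ : ℝ, 0 < M₂ ∧ ∃ C : ℝ, ∀ n : ℕ, 1 ≤ n →
      ∀ S ⊆ binTrees n ×ˢ binTrees n, nuP n S ≤ M₂ * nuT n S + C / n := by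
  refine ⟨3, three_pos, 0, fun n hn S _ => ?_⟩
  rw [zero_div, add_zero]
  exact nuP_le_three_mul_nuT hn S
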